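/- arXiv:1905.00770 — 9 statements merged into one kernel-verified Lean document; each statement's English description precedes it below -/
import Mathlib

section
/- Let P satisfy the pressure assumptions. Then for every v* > 0 there exists α > 0 such that the function f(u; α) = −P(u)·u + α·u − v*² has at least two distinct zeros u₁, u₂ with 0 < u₁ < u₂. -/
/-- Under the pressure assumptions, for every `v* > 0` there exists `α > 0`
such that `f(u; α) = -P(u)·u + α·u - v*²` has at least two distinct positive zeros. -/
theorem stmt0 (P P' P'' : ℝ → ℝ)
    (hPC2 : ContDiffOn ℝ 2 P (Set.Ioi 0))
    (hP'def : ∀ s > (0 : ℝ), HasDerivAt P (P' s) s)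
    (hP''def : ∀ s > (0 : ℝ), HasDerivAt P' (P'' s) s)
    (hP0 : Filter.Tendsto P (nhdsWithin 0 (Set.Ioi 0)) (nhds 0))
    (hPtop : Filter.Tendsto P Filter.atTop Filter.atTop)
    (hP'pos : ∀ s > (0 : ℝ), 0 < P' s)
    (hP''pos : ∀ s > (0 : ℝ), 0 < P'' s) :
    ∀ vs > (0 : ℝ), ∃ α > (0 : ℝ), ∃ u₁ u₂ : ℝ, 0 < u₁ ∧ u₁ < u₂ ∧
      (-P u₁ * u₁ + α * u₁ - vs ^ 2 = 0) ∧ (-P u₂ * u₂ + α * u₂ - vs ^ 2 = 0) := by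
  intro vs hvs
  set α := |P 1| + vs ^ 2 + 1 with hα
  have hα0 : 0 < α := by positivity
  set f : ℝ → ℝ := fun u => -P u * u + α * u - vs ^ 2 with hf
  have hcont : ContinuousOn f (Set.Ioi 0) := by
    have := hPC2.continuousOn
    fun_prop
  have hone : 0 < f 1 := by
    simp only [hf, hα]
    linarith [le_abs_self (P 1)]
  have hlim : Filter.Tendsto f (nhdsWithin 0 (Set.Ioi 0)) (nhds (-0 * 0 + α * 0 - vs ^ 2)) := by
    have hid : Filter.Tendsto (fun u : ℝ => u) (nhdsWithin 0 (Set.Ioi 0)) (nhds 0) :=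
      nhdsWithin_le_nhds
    exact ((hP0.neg.mul hid).add (hid.const_mul α)).sub_const _
  have hneg : -0 * 0 + α * 0 - vs ^ 2 < 0 := by nlinarith
  obtain ⟨a, hfa, ha0, ha1⟩ := ((hlim.eventually_lt_const hneg).and
    (Ioo_mem_nhdsGT (zero_lt_one' ℝ))).exists
  obtain ⟨b, hPb, hb1⟩ := ((hPtop.eventually_ge_atTop α).and
    (Filter.eventually_gt_atTop (1 : ℝ))).exists
  have hfb : f b < 0 := by
    simp only [hf]
    nlinarith [mul_nonneg (sub_nonneg.2 hPb) (zero_lt_one.trans hb1).le, pow_pos hvs 2]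
  obtain ⟨u₁, hu₁, hz₁⟩ := intermediate_value_Ioo ha1.le
    (hcont.mono fun x hx => ha0.trans_le hx.1) ⟨hfa, hone⟩
  obtain ⟨u₂, hu₂, hz₂⟩ := intermediate_value_Ioo' hb1.le
    (hcont.mono fun x hx => zero_lt_one.trans_le hx.1) ⟨hfb, hone⟩
  exact ⟨α, hα0, u₁, u₂, ha0.trans hu₁.1, hu₁.2.trans hu₂.1, hz₁, hz₂⟩
end

section
/- Let P satisfy the pressure assumptions, let v* > 0, α > 0, and suppose u* > 0 satisfies P(u*) + u*·P'(u*) = α. Then u* is the unique critical point of f(·; α) on (0,∞), f(·; α) is strictly increasing on (0, u*) and strictly decreasing on (u*, ∞), f(u*; α) = (u*)²·P'(u*) − v*², and if v*² < (u*)²·P'(u*) then f(·; α) has exactly two zeros in (0,∞), one u₁ ∈ (0, u*) and one u₂ ∈ (u*, ∞). -/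
open Set Filter Topology

/-- If `p` and `q` are strictly increasing on `(0, ∞)` and `q` is positive there, then
`u ↦ p u + u * q u` is strictly increasing on `(0, ∞)`. -/
lemma strictMonoOn_add_id_mul {p q : ℝ → ℝ} (hp : StrictMonoOn p (Ioi 0))
    (hq : StrictMonoOn q (Ioi 0)) (hq_pos : ∀ u > 0, 0 < q u) :
    StrictMonoOn (fun u => p u + u * q u) (Ioi 0) := fun a ha _ hb hab =>
  add_lt_add (hp ha hb hab) (mul_lt_mul hab (hq ha hb hab).le (hq_pos a ha) hb.out.le)

/-- A function with positive derivative on `(0, ∞)` is strictly increasing there. -/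
lemma strictMonoOn_Ioi_of_hasDerivAt_pos {p p' : ℝ → ℝ} (hp : ∀ s > 0, HasDerivAt p (p' s) s)
    (hp' : ∀ s > 0, 0 < p' s) : StrictMonoOn p (Ioi 0) := by
  refine strictMonoOn_of_deriv_pos (convex_Ioi 0)
    (fun s hs => (hp s hs).continuousAt.continuousWithinAt) fun s hs => ?_
  rw [interior_Ioi] at hs
  rw [(hp s hs).deriv]
  exact hp' s hs

/-- A continuous function on `(0, ∞)` that increases strictly up to `m`, decreases strictly after
`m`, is positive at `m` and takes negative values on both sides of `m` has exactly two zeros. -/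
lemma exists_two_zeros_of_unimodal {f : ℝ → ℝ} {m a b : ℝ} (hf : ContinuousOn f (Ioi 0))
    (hmono : StrictMonoOn f (Ioc 0 m)) (hanti : StrictAntiOn f (Ici m)) (hm : 0 < f m)
    (ha : a ∈ Ioo 0 m) (hfa : f a < 0) (hb : m < b) (hfb : f b < 0) :
    ∃ u₁ ∈ Ioo 0 m, ∃ u₂ ∈ Ioi m, f u₁ = 0 ∧ f u₂ = 0 ∧
      ∀ u > 0, f u = 0 → u = u₁ ∨ u = u₂ := by
  obtain ⟨u₁, hu₁, h₁⟩ := intermediate_value_Ioo ha.2.le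
    (hf.mono fun x hx => ha.1.trans_le hx.1) ⟨hfa, hm⟩
  obtain ⟨u₂, hu₂, h₂⟩ := intermediate_value_Ioo' hb.le
    (hf.mono fun x hx => (ha.1.trans ha.2).trans_le hx.1) ⟨hfb, hm⟩
  have hu₁_pos : 0 < u₁ := ha.1.trans hu₁.1
  refine ⟨u₁, ⟨hu₁_pos, hu₁.2⟩, u₂, hu₂.1, h₁, h₂, fun u hu h => ?_⟩
  rcases le_total u m with hum | hum
  · exact .inl (hmono.injOn ⟨hu, hum⟩ ⟨hu₁_pos, hu₁.2.le⟩ (h.trans h₁.symm))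
  · exact .inr (hanti.injOn hum hu₂.1.le (h.trans h₂.symm))


/-- properties of `f(·; α)` around its unique critical point `u*` with
`P(u*) + u*·P'(u*) = α`: monotonicity, value at `u*`, and existence of exactly two zeros
when `v*² < (u*)²·P'(u*)`. -/
theorem stmt1 (P P' P'' : ℝ → ℝ) (vs α ustar : ℝ)
    (hPC2 : ContDiffOn ℝ 2 P (Set.Ioi 0))
    (hP'def : ∀ s > (0 : ℝ), HasDerivAt P (P' s) s)
    (hP''def : ∀ s > (0 : ℝ), HasDerivAt P' (P'' s) s)
    (hP0 : Filter.Tendsto P (nhdsWithin 0 (Set.Ioi 0)) (nhds 0))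
    (hPtop : Filter.Tendsto P Filter.atTop Filter.atTop)
    (hP'pos : ∀ s > (0 : ℝ), 0 < P' s)
    (hP''pos : ∀ s > (0 : ℝ), 0 < P'' s)
    (hvs : 0 < vs) (hα : 0 < α) (hustar : 0 < ustar)
    (hcrit : P ustar + ustar * P' ustar = α) :
    -- f has derivative α - P(u) - u·P'(u) at every u > 0
    (∀ u > (0 : ℝ), HasDerivAt (fun u : ℝ => -P u * u + α * u - vs ^ 2)
        (α - P u - u * P' u) u) ∧
    -- u* is the unique critical point of f on (0, ∞)
    (∀ u > (0 : ℝ), (α - P u - u * P' u = 0 ↔ u = ustar)) ∧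
    -- f strictly increasing on (0, u*), strictly decreasing on (u*, ∞)
    StrictMonoOn (fun u : ℝ => -P u * u + α * u - vs ^ 2) (Set.Ioo 0 ustar) ∧
    StrictAntiOn (fun u : ℝ => -P u * u + α * u - vs ^ 2) (Set.Ioi ustar) ∧
    -- value at the critical point
    (-P ustar * ustar + α * ustar - vs ^ 2 = ustar ^ 2 * P' ustar - vs ^ 2) ∧
    -- exactly two zeros when v*² < (u*)²·P'(u*)
    (vs ^ 2 < ustar ^ 2 * P' ustar →
      ∃ u₁ ∈ Set.Ioo 0 ustar, ∃ u₂ ∈ Set.Ioi ustar,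
        (-P u₁ * u₁ + α * u₁ - vs ^ 2 = 0) ∧ (-P u₂ * u₂ + α * u₂ - vs ^ 2 = 0) ∧
        ∀ u > (0 : ℝ), -P u * u + α * u - vs ^ 2 = 0 → u = u₁ ∨ u = u₂) := by
  set f : ℝ → ℝ := fun u => -P u * u + α * u - vs ^ 2 with hf_def
  have hg : StrictMonoOn (fun u => P u + u * P' u) (Ioi 0) :=
    strictMonoOn_add_id_mul (strictMonoOn_Ioi_of_hasDerivAt_pos hP'def hP'pos)
      (strictMonoOn_Ioi_of_hasDerivAt_pos hP''def hP''pos) hP'pos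
  have hderiv : ∀ u > (0 : ℝ), HasDerivAt f (α - P u - u * P' u) u := fun u hu => by
    refine ((((hP'def u hu).fun_neg.fun_mul (hasDerivAt_id' u)).fun_add
      ((hasDerivAt_id' u).const_mul α)).sub_const (vs ^ 2)).congr_deriv ?_
    ring
  have hcont : ContinuousOn f (Ioi 0) := fun u hu =>
    (hderiv u hu).continuousAt.continuousWithinAt
  have hmono : StrictMonoOn f (Ioc 0 ustar) := by
    refine strictMonoOn_of_deriv_pos (convex_Ioc 0 ustar) (hcont.mono fun u hu => hu.1)
      fun u hu => ?_
    rw [interior_Ioc] at hu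
    have := hg hu.1 hustar hu.2
    rw [(hderiv u hu.1).deriv]
    dsimp only at this
    linarith
  have hanti : StrictAntiOn f (Ici ustar) := by
    refine strictAntiOn_of_deriv_neg (convex_Ici ustar)
      (hcont.mono fun u hu => hustar.trans_le hu) fun u hu => ?_
    rw [interior_Ici] at hu
    have := hg hustar (hustar.trans hu) hu
    rw [(hderiv u (hustar.trans hu)).deriv]
    dsimp only at this
    linarith
  have hval : f ustar = ustar ^ 2 * P' ustar - vs ^ 2 := by
    simp only [hf_def, ← hcrit]
    ring
  refine ⟨hderiv, fun u hu => ⟨fun h => hg.injOn hu hustar ?_, ?_⟩,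
    hmono.mono Ioo_subset_Ioc_self, hanti.mono Ioi_subset_Ici_self, hval, fun hlt => ?_⟩
  · linarith
  · rintro rfl
    linarith
  have hlim : Tendsto f (𝓝[>] 0) (𝓝 (-0 * 0 + α * 0 - vs ^ 2)) := by
    have hid : Tendsto (fun u : ℝ => u) (𝓝[>] 0) (𝓝 0) := tendsto_nhdsWithin_of_tendsto_nhds
      tendsto_id
    exact ((hP0.neg.mul hid).add (hid.const_mul α)).sub_const _
  have hvs2 : 0 < vs ^ 2 := pow_pos hvs 2
  obtain ⟨a, hfa, ha⟩ := ((hlim.eventually_lt_const (by linarith : _ < (0 : ℝ))).and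
    (Ioo_mem_nhdsGT hustar)).exists
  obtain ⟨b, hPb, hb⟩ := ((hPtop.eventually_ge_atTop α).and (eventually_gt_atTop ustar)).exists
  have hfb : f b < 0 := by
    have := mul_le_mul_of_nonneg_right hPb (hustar.trans hb).le
    simp only [hf_def]
    linarith
  exact exists_two_zeros_of_unimodal hcont hmono hanti (by linarith) ha hfa hb hfb
end

section
/- Let P satisfy the pressure assumptions, let v* > 0 and 0 < u₋ < u₊. Define A := { α > 0 : f(·; α) has two zeros u₁ < u₂ in (0,∞) satisfying u₁ < u₋ and u₊ < u₂ }. Then A is nonempty and upward closed (if α ∈ A and α' > α then α' ∈ A); in particular there exists ᾱ > 0 with (ᾱ, ∞) ⊆ A ⊆ [ᾱ, ∞). -/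
open Filter Topology Set

lemma nonneg_of_monotoneOn_of_tendsto_zero {P : ℝ → ℝ} (hmono : MonotoneOn P (Ioi 0))
    (hP0 : Tendsto P (𝓝[>] 0) (𝓝 0)) {s : ℝ} (hs : 0 < s) : 0 ≤ P s := by
  refine le_of_tendsto hP0 ?_
  filter_upwards [Ioo_mem_nhdsGT hs] with t ht
  exact hmono ht.1 hs ht.2.le

/-- If `-P u * u + α * u - c` is positive at `a ≤ b`, it has a zero on either side of `[a, b]`. -/
lemma exists_zeros_outside_of_pos {P : ℝ → ℝ} {α c a b : ℝ} (hcont : ContinuousOn P (Ioi 0))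
    (hP0 : Tendsto P (𝓝[>] 0) (𝓝 0)) (hPtop : Tendsto P atTop atTop) (hc : 0 < c)
    (ha : 0 < a) (hab : a ≤ b) (hfa : 0 < -P a * a + α * a - c)
    (hfb : 0 < -P b * b + α * b - c) :
    ∃ u₁ u₂ : ℝ, 0 < u₁ ∧ u₁ < a ∧ b < u₂ ∧
      -P u₁ * u₁ + α * u₁ - c = 0 ∧ -P u₂ * u₂ + α * u₂ - c = 0 := by
  have hf : ContinuousOn (fun u => -P u * u + α * u - c) (Ioi 0) := by fun_prop
  have hid : Tendsto (fun u : ℝ => u) (𝓝[>] 0) (𝓝 0) := tendsto_nhdsWithin_of_tendsto_nhds tendsto_id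
  have hlim : Tendsto (fun u => -P u * u + α * u - c) (𝓝[>] 0) (𝓝 (-0 * 0 + α * 0 - c)) :=
    ((hP0.neg.mul hid).add (hid.const_mul α)).sub_const c
  obtain ⟨x, hfx, hx0, hxa⟩ :=
    ((hlim.eventually_lt_const (by linarith : -0 * 0 + α * 0 - c < 0)).and
      (Ioo_mem_nhdsGT ha)).exists
  obtain ⟨y, hPy, hby⟩ :=
    ((hPtop.eventually_ge_atTop α).and (eventually_gt_atTop b)).exists
  have hb : 0 < b := ha.trans_le hab
  have hfy : -P y * y + α * y - c < 0 := by
    have := mul_nonneg (sub_nonneg.2 hPy) (hb.trans hby).le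
    linarith
  obtain ⟨u₁, hu₁, h₁⟩ := intermediate_value_Ioo hxa.le
    (hf.mono fun t ht => hx0.trans_le ht.1) ⟨hfx, hfa⟩
  obtain ⟨u₂, hu₂, h₂⟩ := intermediate_value_Ioo' hby.le
    (hf.mono fun t ht => hb.trans_le ht.1) ⟨hfy, hfb⟩
  exact ⟨u₁, u₂, hx0.trans hu₁.1, hu₁.2, hu₂.1, h₁, h₂⟩

/-- the set `A` of parameters `α > 0` for which `f(·; α)` has two positive
zeros `u₁ < u₂` with `u₁ < u₋` and `u₊ < u₂` is nonempty, upward closed, and satisfies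
`(ᾱ, ∞) ⊆ A ⊆ [ᾱ, ∞)` for some `ᾱ > 0`. -/
theorem stmt3 (P P' P'' : ℝ → ℝ) (vs um up : ℝ)
    (hPC2 : ContDiffOn ℝ 2 P (Set.Ioi 0))
    (hP'def : ∀ s > (0 : ℝ), HasDerivAt P (P' s) s)
    (hP''def : ∀ s > (0 : ℝ), HasDerivAt P' (P'' s) s)
    (hP0 : Filter.Tendsto P (nhdsWithin 0 (Set.Ioi 0)) (nhds 0))
    (hPtop : Filter.Tendsto P Filter.atTop Filter.atTop)
    (hP'pos : ∀ s > (0 : ℝ), 0 < P' s)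
    (hP''pos : ∀ s > (0 : ℝ), 0 < P'' s)
    (hvs : 0 < vs) (hum : 0 < um) (humup : um < up) :
    (({α : ℝ | 0 < α ∧ ∃ u₁ u₂ : ℝ, 0 < u₁ ∧ u₁ < u₂ ∧
        (-P u₁ * u₁ + α * u₁ - vs ^ 2 = 0) ∧ (-P u₂ * u₂ + α * u₂ - vs ^ 2 = 0) ∧
        u₁ < um ∧ up < u₂}).Nonempty) ∧
    (∀ α ∈ {α : ℝ | 0 < α ∧ ∃ u₁ u₂ : ℝ, 0 < u₁ ∧ u₁ < u₂ ∧
        (-P u₁ * u₁ + α * u₁ - vs ^ 2 = 0) ∧ (-P u₂ * u₂ + α * u₂ - vs ^ 2 = 0) ∧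
        u₁ < um ∧ up < u₂},
      ∀ α' > α, α' ∈ {α : ℝ | 0 < α ∧ ∃ u₁ u₂ : ℝ, 0 < u₁ ∧ u₁ < u₂ ∧
        (-P u₁ * u₁ + α * u₁ - vs ^ 2 = 0) ∧ (-P u₂ * u₂ + α * u₂ - vs ^ 2 = 0) ∧
        u₁ < um ∧ up < u₂}) ∧
    (∃ abar > (0 : ℝ),
      Set.Ioi abar ⊆ {α : ℝ | 0 < α ∧ ∃ u₁ u₂ : ℝ, 0 < u₁ ∧ u₁ < u₂ ∧
        (-P u₁ * u₁ + α * u₁ - vs ^ 2 = 0) ∧ (-P u₂ * u₂ + α * u₂ - vs ^ 2 = 0) ∧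
        u₁ < um ∧ up < u₂} ∧
      {α : ℝ | 0 < α ∧ ∃ u₁ u₂ : ℝ, 0 < u₁ ∧ u₁ < u₂ ∧
        (-P u₁ * u₁ + α * u₁ - vs ^ 2 = 0) ∧ (-P u₂ * u₂ + α * u₂ - vs ^ 2 = 0) ∧
        u₁ < um ∧ up < u₂} ⊆ Set.Ici abar) := by
  have hcont : ContinuousOn P (Ioi 0) := hPC2.continuousOn
  have hmono : MonotoneOn P (Ioi 0) := by
    refine monotoneOn_of_deriv_nonneg (convex_Ioi 0) hcont ?_ ?_ <;> rw [interior_Ioi]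
    · exact fun s hs => (hP'def s hs).differentiableAt.differentiableWithinAt
    · exact fun s hs => (hP'def s hs).deriv ▸ (hP'pos s hs).le
  have hP : ∀ {s : ℝ}, 0 < s → 0 ≤ P s := nonneg_of_monotoneOn_of_tendsto_zero hmono hP0
  have hv : 0 < vs ^ 2 := by positivity
  have hup : 0 < up := hum.trans humup
  set A := {α : ℝ | 0 < α ∧ ∃ u₁ u₂ : ℝ, 0 < u₁ ∧ u₁ < u₂ ∧
        (-P u₁ * u₁ + α * u₁ - vs ^ 2 = 0) ∧ (-P u₂ * u₂ + α * u₂ - vs ^ 2 = 0) ∧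
        u₁ < um ∧ up < u₂}
  have hne : A.Nonempty := by
    have hPm := hP hum
    have hPp := hP hup
    have hm : 0 < vs ^ 2 / um := by positivity
    have hp : 0 < vs ^ 2 / up := by positivity
    have hm' : vs ^ 2 / um * um = vs ^ 2 := div_mul_cancel₀ _ hum.ne'
    have hp' : vs ^ 2 / up * up = vs ^ 2 := div_mul_cancel₀ _ hup.ne'
    set α := P um + vs ^ 2 / um + (P up + vs ^ 2 / up) with hα
    have hfm : 0 < -P um * um + α * um - vs ^ 2 := by
      have : 0 < (P up + vs ^ 2 / up) * um := by positivity
      rw [hα]; linarith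
    have hfp : 0 < -P up * up + α * up - vs ^ 2 := by
      have : 0 < (P um + vs ^ 2 / um) * up := by positivity
      rw [hα]; linarith
    obtain ⟨u₁, u₂, h0, h1, h2, hz₁, hz₂⟩ :=
      exists_zeros_outside_of_pos hcont hP0 hPtop hv hum humup.le hfm hfp
    exact ⟨α, by positivity, u₁, u₂, h0, by linarith, hz₁, hz₂, h1, h2⟩
  have hupper : ∀ α ∈ A, ∀ α' > α, α' ∈ A := by
    rintro α ⟨hα, a, b, ha, hab, hza, hzb, ham, hpb⟩ α' hα'
    have hfa : 0 < -P a * a + α' * a - vs ^ 2 := by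
      linarith [mul_lt_mul_of_pos_right hα' ha]
    have hfb : 0 < -P b * b + α' * b - vs ^ 2 := by
      linarith [mul_lt_mul_of_pos_right hα' (ha.trans hab)]
    obtain ⟨u₁, u₂, h0, h1, h2, hz₁, hz₂⟩ :=
      exists_zeros_outside_of_pos hcont hP0 hPtop hv ha hab.le hfa hfb
    exact ⟨hα.trans hα', u₁, u₂, h0, by linarith, hz₁, hz₂, h1.trans ham, hpb.trans h2⟩
  have hlower : vs ^ 2 / um ∈ lowerBounds A := by
    rintro α ⟨hα, u, -, hu, -, hz, -, hum', -⟩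
    rw [div_le_iff₀ hum]
    linarith [mul_nonneg (hP hu) hu.le, mul_lt_mul_of_pos_left hum' hα]
  refine ⟨hne, hupper, sInf A, (div_pos hv hum).trans_le (le_csInf hne hlower), ?_, ?_⟩
  · intro α hα
    obtain ⟨β, hβ, hlt⟩ := exists_lt_of_csInf_lt hne hα
    exact hupper β hβ α hlt
  · exact fun α hα => csInf_le ⟨_, hlower⟩ hα
end

section
/- Let P satisfy the pressure assumptions, ν the viscosity assumptions, and Φ the flux-potential assumptions. Fix v* > 0 and 0 < u₋ < u₊. Then there exists ᾱ > 0 such that for every α ≥ ᾱ the function f(·; α) has two zeros u₁(α) < u₂(α) in (0,∞) and Φ(u₁(α)) < Φ(u₋) < Φ(u₊) < Φ(u₂(α)) (equivalently u₁(α) < u₋ < u₊ < u₂(α)). -/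
/-- for fixed `v* > 0` and `0 < u₋ < u₊`, there exists `ᾱ > 0` such that
for every `α ≥ ᾱ` the function `f(·; α)` has two positive zeros `u₁ < u₂` with
`Φ(u₁) < Φ(u₋) < Φ(u₊) < Φ(u₂)` (equivalently `u₁ < u₋ < u₊ < u₂`). -/
theorem stmt5 (P P' P'' ν Φ : ℝ → ℝ) (vs um up : ℝ)
    (hPC2 : ContDiffOn ℝ 2 P (Set.Ioi 0))
    (hP'def : ∀ s > (0 : ℝ), HasDerivAt P (P' s) s)
    (hP''def : ∀ s > (0 : ℝ), HasDerivAt P' (P'' s) s)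
    (hP0 : Filter.Tendsto P (nhdsWithin 0 (Set.Ioi 0)) (nhds 0))
    (hPtop : Filter.Tendsto P Filter.atTop Filter.atTop)
    (hP'pos : ∀ s > (0 : ℝ), 0 < P' s)
    (hP''pos : ∀ s > (0 : ℝ), 0 < P'' s)
    (hνc : ContinuousOn ν (Set.Ioi 0)) (hνpos : ∀ s > (0 : ℝ), 0 < ν s)
    (hΦmono : StrictMonoOn Φ (Set.Ioi 0)) (hΦpos : ∀ u > (0 : ℝ), 0 < Φ u)
    (hΦ'def : ∀ u > (0 : ℝ), HasDerivAt Φ (ν u / u) u)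
    (hΦ0 : Filter.Tendsto Φ (nhdsWithin 0 (Set.Ioi 0)) (nhds 0))
    (hΦtop : Filter.Tendsto Φ Filter.atTop Filter.atTop)
    (hvs : 0 < vs) (hum : 0 < um) (humup : um < up) :
    ∃ abar > (0 : ℝ), ∀ α ≥ abar, ∃ u₁ u₂ : ℝ, 0 < u₁ ∧ u₁ < u₂ ∧
      (-P u₁ * u₁ + α * u₁ - vs ^ 2 = 0) ∧ (-P u₂ * u₂ + α * u₂ - vs ^ 2 = 0) ∧
      Φ u₁ < Φ um ∧ Φ um < Φ up ∧ Φ up < Φ u₂ ∧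
      u₁ < um ∧ up < u₂ := by
  have hup : 0 < up := hum.trans humup
  have hcont : ∀ α : ℝ, ContinuousOn (fun u => -P u * u + α * u - vs ^ 2) (Set.Ioi 0) := by
    intro α
    have hP : ContinuousOn P (Set.Ioi 0) := hPC2.continuousOn
    fun_prop
  refine ⟨|P um| + |P up| + vs ^ 2 / um + 1, by positivity, fun α hα => ?_⟩
  have hpos : ∀ x, um ≤ x → |P um| + |P up| ≥ P x → 0 < -P x * x + α * x - vs ^ 2 := by
    intro x hx hPx
    have hx0 : 0 < x := hum.trans_le hx
    have h1 : vs ^ 2 / um + 1 ≤ α - P x := by linarith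
    have h2 : vs ^ 2 / um * um = vs ^ 2 := div_mul_cancel₀ _ hum.ne'
    have h3 : vs ^ 2 / um * um ≤ vs ^ 2 / um * x := by gcongr
    have h4 : (vs ^ 2 / um + 1) * x ≤ (α - P x) * x := by gcongr
    linarith
  have hfum := hpos um le_rfl (by linarith [le_abs_self (P um), abs_nonneg (P up)])
  have hfup := hpos up humup.le (by linarith [le_abs_self (P up), abs_nonneg (P um)])
  have hlim : Filter.Tendsto (fun u => -P u * u + α * u - vs ^ 2)
      (nhdsWithin 0 (Set.Ioi 0)) (nhds (-0 * 0 + α * 0 - vs ^ 2)) := by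
    have hid : Filter.Tendsto (fun u : ℝ => u) (nhdsWithin 0 (Set.Ioi 0)) (nhds 0) :=
      Filter.tendsto_id.mono_left nhdsWithin_le_nhds
    exact ((hP0.neg.mul hid).add (hid.const_mul α)).sub_const _
  have hneg : -0 * 0 + α * 0 - vs ^ 2 < 0 := by
    have : 0 < vs ^ 2 := by positivity
    linarith
  obtain ⟨e, hfe, he0, hem⟩ :=
    ((hlim.eventually_lt_const hneg).and (Ioo_mem_nhdsGT hum)).exists
  obtain ⟨M, hPM, hM⟩ :=
    ((hPtop.eventually_gt_atTop α).and (Filter.eventually_gt_atTop up)).exists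
  have hfM : -P M * M + α * M - vs ^ 2 < 0 := by
    nlinarith [mul_pos (sub_pos.2 hPM) (hup.trans hM), sq_nonneg vs]
  obtain ⟨u₁, ⟨h1e, h1m⟩, h1⟩ := intermediate_value_Ioo hem.le
    ((hcont α).mono fun x hx => he0.trans_le hx.1) ⟨hfe, hfum⟩
  obtain ⟨u₂, ⟨h2p, h2M⟩, h2⟩ := intermediate_value_Ioo' hM.le
    ((hcont α).mono fun x hx => hup.trans_le hx.1) ⟨hfM, hfup⟩
  have hu₁ : 0 < u₁ := he0.trans h1e
  exact ⟨u₁, u₂, hu₁, h1m.trans (humup.trans h2p), h1, h2, hΦmono hu₁ hum h1m,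
    hΦmono hum hup humup, hΦmono hup (hup.trans h2p) h2p, h1m, h2p⟩
end

section
/- Let P satisfy the pressure assumptions and let v* > 0. For each α > 0 such that f(·; α) has two zeros in (0,∞), denote them u₁(α) < u₂(α). Then there exists α₀ > 0 such that for all α ≥ α₀ the zeros exist and u₁(α) < 2v*²/α; in particular u₁(α) → 0 as α → +∞. Moreover u₂(α) → +∞ as α → +∞. -/
/-- If `P` is monotone, continuous and nonnegative on `(0, ∞)` and tends to `+∞`, then for all large
`α` the function `u ↦ -P u * u + α * u - v ^ 2` has a positive zero below `2 * v ^ 2 / α` and another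
one above any prescribed bound `M`. -/
theorem eventually_exists_small_zero_and_large_zero {P : ℝ → ℝ} {v M : ℝ}
    (hcont : ContinuousOn P (Set.Ioi 0)) (hmono : MonotoneOn P (Set.Ioi 0))
    (hnonneg : ∀ s > (0 : ℝ), 0 ≤ P s) (htop : Filter.Tendsto P Filter.atTop Filter.atTop)
    (hv : 0 < v) (hM : 0 < M) :
    ∀ᶠ α in Filter.atTop, ∃ a b : ℝ, 0 < a ∧ a < b ∧
      (-P a * a + α * a - v ^ 2 = 0) ∧ (-P b * b + α * b - v ^ 2 = 0) ∧
      a < 2 * v ^ 2 / α ∧ M < b := by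
  filter_upwards [Filter.eventually_gt_atTop 0, Filter.eventually_gt_atTop (2 * v ^ 2 / M),
    Filter.eventually_gt_atTop (2 * P M), Filter.eventually_gt_atTop (P M + v ^ 2 / M)]
    with α hα hα₁ hα₂ hα₃
  have hv2 : 0 < v ^ 2 := by positivity
  have hf : ContinuousOn (fun u => -P u * u + α * u - v ^ 2) (Set.Ioi 0) := by fun_prop
  have he : 0 < v ^ 2 / α := by positivity
  have hle : v ^ 2 / α ≤ 2 * v ^ 2 / α := by gcongr; linarith
  have h2e : 0 < 2 * v ^ 2 / α := by positivity
  have h2eM : 2 * v ^ 2 / α < M := by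
    rw [div_lt_iff₀ hM] at hα₁
    rw [div_lt_iff₀ hα]
    linarith
  have hneg : -P (v ^ 2 / α) * (v ^ 2 / α) + α * (v ^ 2 / α) - v ^ 2 ≤ 0 := by
    rw [mul_div_cancel₀ _ hα.ne']
    nlinarith [mul_nonneg (hnonneg _ he) he.le]
  have hpos : 0 < -P (2 * v ^ 2 / α) * (2 * v ^ 2 / α) + α * (2 * v ^ 2 / α) - v ^ 2 := by
    have hP : P (2 * v ^ 2 / α) < α / 2 := by
      linarith [hmono (Set.mem_Ioi.2 h2e) (Set.mem_Ioi.2 hM) h2eM.le]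
    have hprod : α * (2 * v ^ 2 / α) = 2 * v ^ 2 := mul_div_cancel₀ _ hα.ne'
    nlinarith [mul_lt_mul_of_pos_right hP h2e]
  have hMpos : 0 < -P M * M + α * M - v ^ 2 := by
    have hlt := mul_lt_mul_of_pos_right hα₃ hM
    rw [add_mul, div_mul_cancel₀ _ hM.ne'] at hlt
    linarith
  obtain ⟨s, hPs, hMs⟩ :=
    ((htop.eventually_ge_atTop α).and (Filter.eventually_gt_atTop M)).exists
  have hs : -P s * s + α * s - v ^ 2 ≤ 0 := by
    nlinarith [mul_le_mul_of_nonneg_right hPs (hM.trans hMs).le]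
  obtain ⟨a, ha, ha0⟩ := intermediate_value_Ico hle
    (hf.mono fun x hx => he.trans_le hx.1) ⟨hneg, hpos⟩
  obtain ⟨b, hb, hb0⟩ := intermediate_value_Ioc' hMs.le
    (hf.mono fun x hx => hM.trans_le hx.1) ⟨hs, hMpos⟩
  exact ⟨a, b, he.trans_le ha.1, (ha.2.trans h2eM).trans hb.1, ha0, hb0, ha.2, hb.1⟩

/-- denoting by `u₁(α) < u₂(α)` the two positive zeros of `f(·; α)`
(whenever they exist), there is `α₀ > 0` such that for all `α ≥ α₀` the zeros exist and
`u₁(α) < 2v*²/α`; in particular `u₁(α) → 0` and moreover `u₂(α) → +∞` as `α → +∞`. -/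
theorem stmt6 (P P' P'' : ℝ → ℝ) (vs : ℝ) (u1 u2 : ℝ → ℝ)
    (hPC2 : ContDiffOn ℝ 2 P (Set.Ioi 0))
    (hP'def : ∀ s > (0 : ℝ), HasDerivAt P (P' s) s)
    (hP''def : ∀ s > (0 : ℝ), HasDerivAt P' (P'' s) s)
    (hP0 : Filter.Tendsto P (nhdsWithin 0 (Set.Ioi 0)) (nhds 0))
    (hPtop : Filter.Tendsto P Filter.atTop Filter.atTop)
    (hP'pos : ∀ s > (0 : ℝ), 0 < P' s)
    (hP''pos : ∀ s > (0 : ℝ), 0 < P'' s)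
    (hvs : 0 < vs)
    -- u1 α and u2 α denote the two positive zeros of f(·; α), whenever two zeros exist
    (hu12 : ∀ α : ℝ,
      (∃ a b : ℝ, 0 < a ∧ a < b ∧
        (-P a * a + α * a - vs ^ 2 = 0) ∧ (-P b * b + α * b - vs ^ 2 = 0)) →
      0 < u1 α ∧ u1 α < u2 α ∧
      (-P (u1 α) * u1 α + α * u1 α - vs ^ 2 = 0) ∧
      (-P (u2 α) * u2 α + α * u2 α - vs ^ 2 = 0) ∧
      (∀ u > (0 : ℝ), -P u * u + α * u - vs ^ 2 = 0 → u1 α ≤ u ∧ u ≤ u2 α)) :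
    (∃ α₀ > (0 : ℝ), ∀ α ≥ α₀,
      (∃ a b : ℝ, 0 < a ∧ a < b ∧
        (-P a * a + α * a - vs ^ 2 = 0) ∧ (-P b * b + α * b - vs ^ 2 = 0)) ∧
      u1 α < 2 * vs ^ 2 / α) ∧
    Filter.Tendsto u1 Filter.atTop (nhds 0) ∧
    Filter.Tendsto u2 Filter.atTop Filter.atTop := by
  have hcont : ContinuousOn P (Set.Ioi 0) := hPC2.continuousOn
  have hmono : MonotoneOn P (Set.Ioi 0) := by
    refine (strictMonoOn_of_deriv_pos (convex_Ioi 0) hcont fun x hx => ?_).monotoneOn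
    rw [interior_Ioi] at hx
    rw [(hP'def x hx).deriv]
    exact hP'pos x hx
  have hnonneg : ∀ s > (0 : ℝ), 0 ≤ P s := fun s hs => by
    refine le_of_tendsto hP0 ?_
    filter_upwards [Ioo_mem_nhdsGT hs] with t ht
    exact hmono ht.1 hs ht.2.le
  have hzeros : ∀ M > (0 : ℝ), _ := fun M hM =>
    eventually_exists_small_zero_and_large_zero hcont hmono hnonneg hPtop hvs hM
  have hsmall : ∀ᶠ α in Filter.atTop, (∃ a b : ℝ, 0 < a ∧ a < b ∧
      (-P a * a + α * a - vs ^ 2 = 0) ∧ (-P b * b + α * b - vs ^ 2 = 0)) ∧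
      u1 α < 2 * vs ^ 2 / α := by
    filter_upwards [hzeros 1 one_pos] with α ⟨a, b, ha, hab, ha0, hb0, hlt, _⟩
    have hex : ∃ a b : ℝ, 0 < a ∧ a < b ∧ (-P a * a + α * a - vs ^ 2 = 0) ∧
      (-P b * b + α * b - vs ^ 2 = 0) := ⟨a, b, ha, hab, ha0, hb0⟩
    exact ⟨hex, ((hu12 α hex).2.2.2.2 a ha ha0).1.trans_lt hlt⟩
  refine ⟨?_, ?_, Filter.tendsto_atTop.2 fun M => ?_⟩
  · obtain ⟨α₀, h⟩ := Filter.eventually_atTop.1 hsmall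
    exact ⟨max α₀ 1, by positivity, fun α hα => h α ((le_max_left _ _).trans hα)⟩
  · refine tendsto_of_tendsto_of_tendsto_of_le_of_le' tendsto_const_nhds
      (tendsto_const_nhds.div_atTop Filter.tendsto_id : Filter.Tendsto
        (fun α : ℝ => 2 * vs ^ 2 / α) Filter.atTop (nhds 0)) ?_ ?_
    · exact hsmall.mono fun α h => (hu12 α h.1).1.le
    · exact hsmall.mono fun α h => h.2.le
  · filter_upwards [hzeros (max M 1) (by positivity)]
      with α ⟨a, b, ha, hab, ha0, hb0, _, hMb⟩
    have hbu := ((hu12 α ⟨a, b, ha, hab, ha0, hb0⟩).2.2.2.2 b (ha.trans hab) hb0).2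
    exact (le_max_left M 1).trans (hMb.le.trans hbu)
end

section
/- Let P satisfy the pressure assumptions, ν the viscosity assumptions, let ε > 0, v* > 0 and 0 < u₋ < u₊, and let A := { α > 0 : f(·; α) has two zeros u₁ < u₂ in (0,∞) with u₁ < u₋ and u₊ < u₂ }, with ᾱ := inf A. For α ∈ A define G(α) := ε·v*·∫_{u₋}^{u₊} ν(u) / (u·f(u; α)) du. Then G is strictly decreasing on A, G(α) → 0 as α → +∞, and G(α) → +∞ as α → ᾱ⁺. Consequently, for every ℓ > 0 there exists a unique α* ∈ A with G(α*) = 2ℓ. -/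
open Set Filter Topology in
theorem continuousOn_div_const_sub {w h : ℝ → ℝ} {a b M α : ℝ}
    (hw : ContinuousOn w (Icc a b)) (hh : ContinuousOn h (Icc a b))
    (hM : ∀ u ∈ Icc a b, h u ≤ M) (hα : M < α) :
    ContinuousOn (fun u => w u / (α - h u)) (Icc a b) :=
  hw.div (continuousOn_const.sub hh) fun u hu => by linarith [hM u hu]

open Set Filter Topology in
theorem strictAntiOn_integral_div_const_sub {w h : ℝ → ℝ} {a b M : ℝ} (hab : a < b)
    (hw : ContinuousOn w (Icc a b)) (hwpos : ∀ u ∈ Icc a b, 0 < w u)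
    (hh : ContinuousOn h (Icc a b)) (hM : ∀ u ∈ Icc a b, h u ≤ M) :
    StrictAntiOn (fun α => ∫ u in a..b, w u / (α - h u)) (Ioi M) := by
  intro α hα β hβ hαβ
  rw [mem_Ioi] at hα hβ
  have hlt : ∀ u ∈ Icc a b, w u / (β - h u) < w u / (α - h u) := fun u hu =>
    div_lt_div_of_pos_left (hwpos u hu) (by linarith [hM u hu]) (by linarith)
  exact intervalIntegral.integral_lt_integral_of_continuousOn_of_le_of_exists_lt hab
    (continuousOn_div_const_sub hw hh hM hβ) (continuousOn_div_const_sub hw hh hM hα)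
    (fun u hu => (hlt u (Ioc_subset_Icc_self hu)).le)
    ⟨a, left_mem_Icc.2 hab.le, hlt a (left_mem_Icc.2 hab.le)⟩

open Set Filter Topology in
theorem tendsto_integral_div_const_sub_atTop {w h : ℝ → ℝ} {a b M : ℝ} (hab : a < b)
    (hw : ContinuousOn w (Icc a b)) (hM : ∀ u ∈ Icc a b, h u ≤ M) :
    Tendsto (fun α => ∫ u in a..b, w u / (α - h u)) atTop (𝓝 0) := by
  obtain ⟨K, hK⟩ := isCompact_Icc.exists_bound_of_continuousOn hw
  have hK0 : 0 ≤ K := (norm_nonneg _).trans (hK a (left_mem_Icc.2 hab.le))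
  have hlim : Tendsto (fun α : ℝ => K / (α - M) * |b - a|) atTop (𝓝 0) := by
    have h1 : Tendsto (fun α : ℝ => α - M) atTop atTop :=
      tendsto_atTop_add_const_right _ _ tendsto_id
    simpa using (h1.const_div_atTop K).mul_const |b - a|
  refine squeeze_zero_norm' ?_ hlim
  filter_upwards [eventually_gt_atTop M] with α hα
  refine intervalIntegral.norm_integral_le_of_norm_le_const fun u hu => ?_
  rw [uIoc_of_le hab.le] at hu
  have hu' := Ioc_subset_Icc_self hu
  have hle := hM u hu'
  rw [norm_div, Real.norm_of_nonneg (by linarith : 0 ≤ α - h u)]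
  exact div_le_div₀ hK0 (hK u hu') (by linarith) (by linarith)

open Set Filter Topology in
theorem continuousOn_integral_div_const_sub {w h : ℝ → ℝ} {a b M : ℝ} (hab : a < b)
    (hw : ContinuousOn w (Icc a b)) (hh : ContinuousOn h (Icc a b))
    (hM : ∀ u ∈ Icc a b, h u ≤ M) :
    ContinuousOn (fun α => ∫ u in a..b, w u / (α - h u)) (Ioi M) := by
  obtain ⟨K, hK⟩ := isCompact_Icc.exists_bound_of_continuousOn hw
  have hK0 : 0 ≤ K := (norm_nonneg _).trans (hK a (left_mem_Icc.2 hab.le))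
  intro α hα
  rw [mem_Ioi] at hα
  refine ContinuousAt.continuousWithinAt ?_
  have hmid : (M + α) / 2 < α := by linarith
  refine intervalIntegral.continuousAt_of_dominated_interval
    (bound := fun _ => K / ((α - M) / 2)) ?_ ?_ intervalIntegrable_const ?_
  · filter_upwards [lt_mem_nhds hα] with β hβ
    rw [uIoc_of_le hab.le]
    exact ((continuousOn_div_const_sub hw hh hM hβ).mono
      Ioc_subset_Icc_self).aestronglyMeasurable measurableSet_Ioc
  · filter_upwards [lt_mem_nhds hmid] with β hβ
    refine Eventually.of_forall fun u hu => ?_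
    rw [uIoc_of_le hab.le] at hu
    have hu' := Ioc_subset_Icc_self hu
    have hle := hM u hu'
    rw [norm_div, Real.norm_of_nonneg (by linarith : 0 ≤ β - h u)]
    exact div_le_div₀ hK0 (hK u hu') (by linarith) (by linarith)
  · refine Eventually.of_forall fun u hu => ?_
    rw [uIoc_of_le hab.le] at hu
    have hle := hM u (Ioc_subset_Icc_self hu)
    exact continuousAt_const.div (continuousAt_id.sub continuousAt_const)
      (sub_pos.2 (hle.trans_lt hα)).ne'

theorem integral_inv_const_add_mul {L δ d : ℝ} (hL : 0 < L) (hδ : 0 < δ) (hd : 0 ≤ d) :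
    ∫ x in (0 : ℝ)..d, 1 / (δ + L * x) = Real.log ((δ + L * d) / δ) / L := by
  have h := intervalIntegral.integral_comp_add_mul (fun y : ℝ => 1 / y) hL.ne' δ
    (a := 0) (b := d)
  rw [h, integral_one_div_of_pos (by simpa using hδ) (by positivity)]
  simp [div_eq_inv_mul]

theorem integral_inv_const_add_mul_abs {a b c L δ : ℝ} (hab : a ≤ b) (hc : c = a ∨ c = b)
    (hL : 0 < L) (hδ : 0 < δ) :
    ∫ u in a..b, 1 / (δ + L * |u - c|) = Real.log ((δ + L * (b - a)) / δ) / L := by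
  rw [← integral_inv_const_add_mul hL hδ (sub_nonneg.2 hab)]
  rcases hc with rfl | rfl
  · rw [← sub_self c, ← intervalIntegral.integral_comp_sub_right
      (fun x => 1 / (δ + L * x)) c]
    refine intervalIntegral.integral_congr fun u hu => ?_
    rw [Set.uIcc_of_le hab] at hu
    simp only [abs_of_nonneg (sub_nonneg.2 hu.1)]
  · rw [← sub_self c, ← intervalIntegral.integral_comp_sub_left
      (fun x => 1 / (δ + L * x)) c]
    refine intervalIntegral.integral_congr fun u hu => ?_
    rw [Set.uIcc_of_le hab] at hu
    simp only [abs_of_nonpos (sub_nonpos.2 hu.2), neg_sub]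

open Set Filter Topology in
theorem tendsto_integral_div_const_sub_nhdsGT {w h : ℝ → ℝ} {a b c L M : ℝ} (hab : a < b)
    (hw : ContinuousOn w (Icc a b)) (hwpos : ∀ u ∈ Icc a b, 0 < w u)
    (hh : ContinuousOn h (Icc a b)) (hM : ∀ u ∈ Icc a b, h u ≤ M)
    (hc : c = a ∨ c = b) (hL : 0 < L) (hlip : ∀ u ∈ Icc a b, M - L * |u - c| ≤ h u) :
    Tendsto (fun α => ∫ u in a..b, w u / (α - h u)) (𝓝[>] M) atTop := by
  obtain ⟨x, hx, hmin⟩ := isCompact_Icc.exists_isMinOn (nonempty_Icc.2 hab.le) hw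
  have hk : 0 < w x := hwpos x hx
  have hsub : Tendsto (fun α : ℝ => α - M) (𝓝[>] M) (𝓝[>] 0) := by
    refine tendsto_nhdsWithin_iff.2 ⟨?_, ?_⟩
    · have : Tendsto (fun α : ℝ => α - M) (𝓝 M) (𝓝 (M - M)) := by
        exact (continuous_id.sub continuous_const).tendsto M
      rw [sub_self] at this
      exact this.mono_left nhdsWithin_le_nhds
    · filter_upwards [self_mem_nhdsWithin] with α hα
      exact sub_pos.2 (mem_Ioi.1 hα)
  have hquot : Tendsto (fun δ : ℝ => (δ + L * (b - a)) / δ) (𝓝[>] 0) atTop := by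
    have hd : 0 < L * (b - a) := mul_pos hL (sub_pos.2 hab)
    refine tendsto_atTop_mono' _ ?_ (tendsto_inv_nhdsGT_zero.const_mul_atTop hd)
    filter_upwards [self_mem_nhdsWithin] with δ hδ
    rw [div_eq_mul_inv, add_mul]
    have : 0 ≤ δ * δ⁻¹ := mul_nonneg (le_of_lt hδ) (inv_nonneg.2 (le_of_lt hδ))
    linarith
  have hlog : Tendsto (fun α : ℝ =>
      w x * (Real.log ((α - M + L * (b - a)) / (α - M)) / L)) (𝓝[>] M) atTop :=
    (((Real.tendsto_log_atTop.comp (hquot.comp hsub)).atTop_div_const hL)).const_mul_atTop hk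
  refine tendsto_atTop_mono' _ ?_ hlog
  filter_upwards [self_mem_nhdsWithin] with α hα
  have hδ : 0 < α - M := sub_pos.2 hα
  have hden : ∀ u, 0 < α - M + L * |u - c| := fun u => by positivity
  rw [← integral_inv_const_add_mul_abs hab.le hc hL hδ, ← intervalIntegral.integral_const_mul]
  refine intervalIntegral.integral_mono_on hab.le ?_ ?_ fun u hu => ?_
  · refine Continuous.intervalIntegrable ?_ _ _
    exact continuous_const.mul (continuous_const.div (by fun_prop) fun u => (hden u).ne')
  · exact (continuousOn_div_const_sub hw hh hM hα).intervalIntegrable_of_Icc hab.le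
  · rw [mul_one_div]
    have h1 := hM u hu
    have h2 := hlip u hu
    exact div_le_div₀ (hwpos u hu).le (hmin hu) (by linarith) (by linarith)

open Set Filter Topology in
theorem nonneg_of_strictMonoOn_of_tendsto_zero {P : ℝ → ℝ} (hmono : StrictMonoOn P (Ioi 0))
    (hP0 : Tendsto P (𝓝[>] 0) (𝓝 0)) {s : ℝ} (hs : 0 < s) : 0 ≤ P s := by
  refine le_of_tendsto hP0 ?_
  filter_upwards [Ioo_mem_nhdsGT hs] with x hx
  exact (hmono hx.1 hs hx.2).le

open Set in
theorem strictConvexOn_add_div {P : ℝ → ℝ} (hP : StrictConvexOn ℝ (Ioi 0) P) {k : ℝ}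
    (hk : 0 ≤ k) : StrictConvexOn ℝ (Ioi 0) (fun u => P u + k / u) := by
  have hinv : ConvexOn ℝ (Ioi (0 : ℝ)) fun u => k / u := by
    have := (convexOn_zpow (𝕜 := ℝ) (-1)).smul hk
    simpa [div_eq_mul_inv] using this
  exact hP.add_convexOn hinv

open Set Filter Topology in
theorem exists_two_level_points_iff {P : ℝ → ℝ} (hPc : ContinuousOn P (Ioi 0))
    (hPconv : StrictConvexOn ℝ (Ioi 0) P) (hPnn : ∀ s > 0, 0 ≤ P s)
    (hPtop : Tendsto P atTop atTop) {k a b α : ℝ} (hk : 0 < k) (ha : 0 < a) (hab : a < b) :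
    (0 < α ∧ ∃ u₁ u₂ : ℝ, 0 < u₁ ∧ u₁ < u₂ ∧ P u₁ + k / u₁ = α ∧ P u₂ + k / u₂ = α ∧
      u₁ < a ∧ b < u₂) ↔ max (P a + k / a) (P b + k / b) < α := by
  have hb : 0 < b := ha.trans hab
  have hconv := strictConvexOn_add_div hPconv hk.le
  have hcont : ContinuousOn (fun u => P u + k / u) (Ioi 0) :=
    hPc.add (continuousOn_const.div continuousOn_id fun u hu => (mem_Ioi.1 hu).ne')
  constructor
  · rintro ⟨-, u₁, u₂, h0, h12, e1, e2, h1, h2⟩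
    have key : ∀ u ∈ Ioo u₁ u₂, P u + k / u < α := fun u hu => by
      have := hconv.lt_on_openSegment (mem_Ioi.2 h0) (mem_Ioi.2 (h0.trans h12)) h12.ne
        (by rwa [openSegment_eq_Ioo h12])
      simpa only [e1, e2, max_self] using this
    exact max_lt (key a ⟨h1, hab.trans h2⟩) (key b ⟨h1.trans hab, h2⟩)
  · intro hα
    obtain ⟨hαa, hαb⟩ := max_lt_iff.1 hα
    have hka : k / a < α := by linarith [hPnn a ha]
    have hα0 : 0 < α := (div_pos hk ha).trans hka
    have hx0 : 0 < k / α := div_pos hk hα0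
    have hxa : k / α < a := by rw [div_lt_iff₀ ha] at hka; rw [div_lt_iff₀ hα0]; linarith
    have hx : α ≤ P (k / α) + k / (k / α) := by
      rw [div_div_cancel₀ hk.ne']
      linarith [hPnn _ hx0]
    obtain ⟨u₁, hu₁, e1⟩ := intermediate_value_Icc' hxa.le
      (hcont.mono fun u hu => hx0.trans_le hu.1) ⟨hαa.le, hx⟩
    obtain ⟨y, hyα, hyb⟩ :=
      ((hPtop.eventually_ge_atTop α).and (eventually_gt_atTop b)).exists
    have hy : α ≤ P y + k / y := by linarith [div_pos hk (hb.trans hyb)]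
    obtain ⟨u₂, hu₂, e2⟩ := intermediate_value_Icc hyb.le
      (hcont.mono fun u hu => hb.trans_le hu.1) ⟨hαb.le, hy⟩
    have h1 : u₁ < a := hu₁.2.lt_of_ne (by rintro rfl; exact hαa.ne e1)
    have h2 : b < u₂ := hu₂.1.lt_of_ne (by rintro rfl; exact hαb.ne e2)
    exact ⟨hα0, u₁, u₂, hx0.trans_le hu₁.1, h1.trans (hab.trans h2), e1, e2, h1, h2⟩

open Set Filter Topology in
theorem existsUnique_eq_of_strictAntiOn_Ioi {G : ℝ → ℝ} {M y : ℝ}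
    (hanti : StrictAntiOn G (Ioi M)) (hcont : ContinuousOn G (Ioi M))
    (htop : Tendsto G atTop (𝓝 0)) (hM : Tendsto G (𝓝[>] M) atTop) (hy : 0 < y) :
    ∃! α, α ∈ Ioi M ∧ G α = y := by
  obtain ⟨p, hp, hpM⟩ := ((hM.eventually_ge_atTop y).and self_mem_nhdsWithin).exists
  obtain ⟨q, hq, hqM⟩ := ((htop.eventually (ge_mem_nhds hy)).and (eventually_gt_atTop M)).exists
  obtain ⟨α, hα, e⟩ := isPreconnected_Ioi.intermediate_value (mem_Ioi.2 hqM) hpM hcont ⟨hq, hp⟩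
  exact ⟨α, ⟨hα, e⟩, fun β hβ => hanti.injOn hβ.1 hα (hβ.2.trans e.symm)⟩

/-- on the set `A` of admissible parameters, the length functional
`G(α) = ε·v*·∫_{u₋}^{u₊} ν(u)/(u·f(u;α)) du` is strictly decreasing, tends to `0` at
`+∞` and to `+∞` as `α → ᾱ⁺` (`ᾱ = inf A`); hence for every `ℓ > 0` there is a unique
`α* ∈ A` with `G(α*) = 2ℓ`. -/
theorem stmt7 (P P' P'' ν : ℝ → ℝ) (ε vs um up : ℝ)
    (hPC2 : ContDiffOn ℝ 2 P (Set.Ioi 0))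
    (hP'def : ∀ s > (0 : ℝ), HasDerivAt P (P' s) s)
    (hP''def : ∀ s > (0 : ℝ), HasDerivAt P' (P'' s) s)
    (hP0 : Filter.Tendsto P (nhdsWithin 0 (Set.Ioi 0)) (nhds 0))
    (hPtop : Filter.Tendsto P Filter.atTop Filter.atTop)
    (hP'pos : ∀ s > (0 : ℝ), 0 < P' s)
    (hP''pos : ∀ s > (0 : ℝ), 0 < P'' s)
    (hνc : ContinuousOn ν (Set.Ioi 0)) (hνpos : ∀ s > (0 : ℝ), 0 < ν s)
    (hε : 0 < ε) (hvs : 0 < vs) (hum : 0 < um) (humup : um < up)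
    (A : Set ℝ)
    (hA : A = {α : ℝ | 0 < α ∧ ∃ u₁ u₂ : ℝ, 0 < u₁ ∧ u₁ < u₂ ∧
      (-P u₁ * u₁ + α * u₁ - vs ^ 2 = 0) ∧ (-P u₂ * u₂ + α * u₂ - vs ^ 2 = 0) ∧
      u₁ < um ∧ up < u₂})
    (G : ℝ → ℝ)
    (hG : G = fun α : ℝ =>
      ε * vs * ∫ u in um..up, ν u / (u * (-P u * u + α * u - vs ^ 2))) :
    StrictAntiOn G A ∧
    Filter.Tendsto G Filter.atTop (nhds 0) ∧
    Filter.Tendsto G (nhdsWithin (sInf A) (Set.Ioi (sInf A))) Filter.atTop ∧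
    (∀ l > (0 : ℝ), ∃! αs : ℝ, αs ∈ A ∧ G αs = 2 * l) := by
  have hup : 0 < up := hum.trans humup
  have hpos : ∀ u ∈ Set.Icc um up, 0 < u := fun u hu => hum.trans_le hu.1
  have hPc : ContinuousOn P (Set.Ioi 0) := hPC2.continuousOn
  have hP'c : ContinuousOn P' (Set.Ioi 0) := fun s hs =>
    (hP''def s hs).continuousAt.continuousWithinAt
  have hPmono : StrictMonoOn P (Set.Ioi 0) :=
    strictMonoOn_of_deriv_pos (convex_Ioi 0) hPc fun s hs => by
      rw [interior_Ioi] at hs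
      rw [(hP'def s hs).deriv]
      exact hP'pos s hs
  have hP'mono : StrictMonoOn P' (Set.Ioi 0) :=
    strictMonoOn_of_deriv_pos (convex_Ioi 0) hP'c fun s hs => by
      rw [interior_Ioi] at hs
      rw [(hP''def s hs).deriv]
      exact hP''pos s hs
  have hPconv : StrictConvexOn ℝ (Set.Ioi 0) P := by
    refine StrictMonoOn.strictConvexOn_of_deriv (convex_Ioi 0) hPc ?_
    rw [interior_Ioi]
    exact hP'mono.congr fun s hs => (hP'def s hs).deriv.symm
  have hk : 0 < vs ^ 2 := by positivity
  set h : ℝ → ℝ := fun u => P u + vs ^ 2 / u with hh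
  set w : ℝ → ℝ := fun u => ν u / u ^ 2 with hwdef
  set M : ℝ := max (h um) (h up) with hMdef
  have hfac : ∀ α u : ℝ, 0 < u → -P u * u + α * u - vs ^ 2 = u * (α - h u) := by
    intro α u hu
    simp only [hh]
    field_simp
    ring
  have hAM : A = Set.Ioi M := by
    rw [hA]
    ext α
    rw [Set.mem_Ioi, hMdef, ← exists_two_level_points_iff hPc hPconv
      (fun s hs => nonneg_of_strictMonoOn_of_tendsto_zero hPmono hP0 hs) hPtop hk hum humup]
    have hzero : ∀ u : ℝ, 0 < u → (-P u * u + α * u - vs ^ 2 = 0 ↔ h u = α) := fun u hu => by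
      rw [hfac α u hu, mul_eq_zero, or_iff_right hu.ne', sub_eq_zero, eq_comm]
    refine and_congr_right fun _ => exists_congr fun u₁ => exists_congr fun u₂ => ?_
    refine and_congr_right fun h1 => and_congr_right fun h12 => ?_
    rw [hzero u₁ h1, hzero u₂ (h1.trans h12)]
  have hwc : ContinuousOn w (Set.Icc um up) :=
    (hνc.mono hpos).div (by fun_prop) fun u hu => (pow_pos (hpos u hu) 2).ne'
  have hwpos : ∀ u ∈ Set.Icc um up, 0 < w u := fun u hu =>
    div_pos (hνpos u (hpos u hu)) (pow_pos (hpos u hu) 2)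
  have hderiv : ∀ u ∈ Set.Icc um up,
      HasDerivWithinAt h (P' u - vs ^ 2 / u ^ 2) (Set.Icc um up) u := fun u hu => by
    have hu0 := hpos u hu
    have := (hP'def u hu0).add ((hasDerivAt_inv hu0.ne').const_mul (vs ^ 2))
    refine (this.congr_deriv ?_).hasDerivWithinAt
    ring
  have hhc : ContinuousOn h (Set.Icc um up) := fun u hu => (hderiv u hu).continuousWithinAt
  have hhM : ∀ u ∈ Set.Icc um up, h u ≤ M := fun u hu =>
    (strictConvexOn_add_div hPconv hk.le).convexOn.le_max_of_mem_Icc hum hup hu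
  obtain ⟨L, hL⟩ := isCompact_Icc.exists_bound_of_continuousOn
    (f := fun u => P' u - vs ^ 2 / u ^ 2) (s := Set.Icc um up)
    ((hP'c.mono hpos).sub
      (continuousOn_const.div (by fun_prop) fun u hu => (pow_pos (hpos u hu) 2).ne'))
  obtain ⟨c, hc, hcM⟩ : ∃ c, (c = um ∨ c = up) ∧ h c = M := by
    rcases max_choice (h um) (h up) with e | e
    · exact ⟨um, Or.inl rfl, e.symm⟩
    · exact ⟨up, Or.inr rfl, e.symm⟩
  have hcI : c ∈ Set.Icc um up := by
    rcases hc with rfl | rfl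
    · exact Set.left_mem_Icc.2 humup.le
    · exact Set.right_mem_Icc.2 humup.le
  have hlip : ∀ u ∈ Set.Icc um up, M - (|L| + 1) * |u - c| ≤ h u := fun u hu => by
    have h1 := (convex_Icc um up).norm_image_sub_le_of_norm_hasDerivWithin_le
      (C := |L| + 1) hderiv
      (fun x hx => (hL x hx).trans ((le_abs_self L).trans (by linarith))) hcI hu
    rw [Real.norm_eq_abs, Real.norm_eq_abs, hcM] at h1
    linarith [neg_abs_le (h u - M)]
  have hGI : G = fun α => ε * vs * ∫ u in um..up, w u / (α - h u) := by
    rw [hG]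
    funext α
    congr 1
    refine intervalIntegral.integral_congr fun u hu => ?_
    rw [Set.uIcc_of_le humup.le] at hu
    simp only [hfac α u (hpos u hu), hwdef]
    rw [div_div]
    ring
  have hεv : 0 < ε * vs := mul_pos hε hvs
  have hanti : StrictAntiOn G (Set.Ioi M) := hGI ▸ fun α hα β hβ hαβ =>
    mul_lt_mul_of_pos_left
      (strictAntiOn_integral_div_const_sub humup hwc hwpos hhc hhM hα hβ hαβ) hεv
  have hcont : ContinuousOn G (Set.Ioi M) := hGI ▸
    (continuousOn_integral_div_const_sub humup hwc hhc hhM).const_mul (ε * vs)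
  have htop : Filter.Tendsto G Filter.atTop (nhds 0) := by
    rw [hGI]
    simpa using (tendsto_integral_div_const_sub_atTop humup hwc hhM).const_mul (ε * vs)
  have hbot : Filter.Tendsto G (nhdsWithin M (Set.Ioi M)) Filter.atTop := hGI ▸
    (tendsto_integral_div_const_sub_nhdsGT humup hwc hwpos hhc hhM hc (by positivity)
      hlip).const_mul_atTop hεv
  rw [hAM, csInf_Ioi]
  exact ⟨hanti, htop, hbot, fun l hl =>
    existsUnique_eq_of_strictAntiOn_Ioi hanti hcont htop hbot (by linarith)⟩
end

section
/- Let ε > 0, ℓ > 0, 0 < u₋ < u₊ and v₋ > 0. Let P satisfy the pressure assumptions, with z ↦ P(z)/z² integrable on (0, a) for every a > 0, let ν satisfy the viscosity assumptions and Φ the flux-potential assumptions. Set f(u) := u·∫₀^u P(z)/z² dz, and assume the compatibility conditions v₋²·(u₊ − u₋) = u₋·u₊·(P(u₊) − P(u₋)) and (v₋³/(2u₊²) + v₋·f'(u₊)) − (v₋³/(2u₋²) + v₋·f'(u₋)) ≤ 0. Then there exist a unique constant α ∈ ℝ and a unique C¹ function ū : [−ℓ, ℓ] → (0,∞) such that ū(−ℓ)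 = u₋, ū(ℓ) = u₊, and ε·v₋·(ν(ū(x))/ū(x))·ū'(x) = −P(ū(x))·ū(x) + α·ū(x) − v₋² for every x ∈ [−ℓ, ℓ]. Equivalently, the pair (ū, v̄) with v̄ ≡ v₋ is the unique stationary solution of the compressible Navier–Stokes system uₜ + vₓ = 0, vₜ + (v²/u + P(u) − ε·ν(u)·(v/u)ₓ)ₓ = 0 with boundary conditions u(±ℓ) = u±, v(−ℓ) = v₋. -/
open Set Filter Topology

/-- A function vanishing at `a` whose derivative is positive at each of its zeros
is positive to the right of `a`. -/
lemma pos_of_deriv_pos_at_zeros {a b : ℝ} {d d' : ℝ → ℝ}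
    (hd : ∀ x ∈ Icc a b, HasDerivAt d (d' x) x) (ha : d a = 0)
    (hz : ∀ x ∈ Icc a b, d x = 0 → 0 < d' x) : ∀ x ∈ Ioc a b, 0 < d x := by
  have hnonneg : ∀ x ∈ Icc a b, 0 ≤ d x := fun x hx =>
    image_le_of_deriv_right_lt_deriv_boundary' (f := fun _ => (0 : ℝ)) (f' := fun _ => 0)
      continuousOn_const (fun _ _ => hasDerivWithinAt_const ..) ha.ge
      (fun y hy => (hd y hy).continuousAt.continuousWithinAt)
      (fun y hy => (hd y (Ico_subset_Icc_self hy)).hasDerivWithinAt)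
      (fun y hy h => hz y (Ico_subset_Icc_self hy) h.symm) hx
  intro x hx
  have hx' := Ioc_subset_Icc_self hx
  refine (hnonneg x hx').lt_of_ne fun h0 => ?_
  have hlim : Tendsto (slope d x) (𝓝[<] x) (𝓝 (d' x)) :=
    (hasDerivAt_iff_tendsto_slope.1 (hd x hx')).mono_left
      (nhdsWithin_mono _ fun y hy => ne_of_lt hy)
  have hle : d' x ≤ 0 := by
    refine le_of_tendsto hlim ?_
    filter_upwards [Ioo_mem_nhdsLT hx.1] with y hy
    rw [slope_def_field, ← h0, sub_zero]
    exact div_nonpos_of_nonneg_of_nonpos (hnonneg y ⟨hy.1.le, hy.2.le.trans hx.2⟩)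
      (sub_nonpos.2 hy.2.le)
  exact (hz x hx' h0.symm).not_ge hle

/-- The transit time `∫ c / (δ + q)` attains every positive value when `q` vanishes at
least linearly at the left endpoint. -/
lemma exists_integral_div_add_eq {a b K m L : ℝ} {c q : ℝ → ℝ} (hab : a < b) (hK : 0 < K)
    (hm : 0 < m) (hL : 0 < L) (hc : Continuous c) (hq : Continuous q)
    (hmc : ∀ s, m ≤ c s) (hq0 : ∀ s, 0 ≤ q s) (hqK : ∀ s ∈ Icc a b, q s ≤ K * (s - a)) :
    ∃ δ > 0, ∫ s in a..b, c s / (δ + q s) = L := by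
  have hden : ∀ t s, 0 < Real.exp t + q s := fun t s =>
    add_pos_of_pos_of_nonneg (Real.exp_pos t) (hq0 s)
  have hcont : Continuous fun t : ℝ => ∫ s in a..b, c s / (Real.exp t + q s) := by
    refine intervalIntegral.continuous_parametric_intervalIntegral_of_continuous' ?_ a b
    exact Continuous.div (by fun_prop) (by fun_prop) fun p => (hden p.1 p.2).ne'
  have hint : ∀ t : ℝ, IntervalIntegrable (fun s => c s / (Real.exp t + q s))
      MeasureTheory.volume a b := fun t =>
    (Continuous.div hc (by fun_prop) fun s => (hden t s).ne').intervalIntegrable a b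
  have hI : 0 < ∫ s in a..b, c s :=
    intervalIntegral.intervalIntegral_pos_of_pos (hc.intervalIntegrable a b)
      (fun s => hm.trans_le (hmc s)) hab
  have hlow : ∃ t : ℝ, (∫ s in a..b, c s / (Real.exp t + q s)) ≤ L := by
    refine ⟨Real.log ((∫ s in a..b, c s) / L), ?_⟩
    have hb : (∫ s in a..b, c s / (Real.exp (Real.log ((∫ s in a..b, c s) / L)) + q s)) ≤
        ∫ s in a..b, c s / ((∫ s in a..b, c s) / L) := by
      refine intervalIntegral.integral_mono_on hab.le (hint _)
        ((hc.div_const _).intervalIntegrable a b) fun s _ => ?_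
      rw [Real.exp_log (div_pos hI hL)]
      exact div_le_div_of_nonneg_left (hm.le.trans (hmc s)) (div_pos hI hL)
        (le_add_of_nonneg_right (hq0 s))
    refine hb.trans (le_of_eq ?_)
    rw [intervalIntegral.integral_div]
    field_simp
  have hhigh : ∃ t : ℝ, L ≤ ∫ s in a..b, c s / (Real.exp t + q s) := by
    have hKab : 0 < K * (b - a) := mul_pos hK (sub_pos.2 hab)
    refine ⟨Real.log (K * (b - a)) - L * K / m, ?_⟩
    set t : ℝ := Real.log (K * (b - a)) - L * K / m with ht
    have hpos : ∀ s ∈ Icc a b, 0 < Real.exp t + K * (s - a) := fun s hs =>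
      add_pos_of_pos_of_nonneg (Real.exp_pos t) (mul_nonneg hK.le (sub_nonneg.2 hs.1))
    have hint' : IntervalIntegrable (fun s => m / (Real.exp t + K * (s - a)))
        MeasureTheory.volume a b := by
      refine ContinuousOn.intervalIntegrable ?_
      rw [uIcc_of_le hab.le]
      exact ContinuousOn.div continuousOn_const (by fun_prop) fun s hs => (hpos s hs).ne'
    have heq : ∫ s in a..b, m / (Real.exp t + K * (s - a)) =
        m / K * Real.log (Real.exp t + K * (b - a)) -
          m / K * Real.log (Real.exp t + K * (a - a)) := by
      refine intervalIntegral.integral_eq_sub_of_hasDerivAt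
        (f := fun s => m / K * Real.log (Real.exp t + K * (s - a))) (fun s hs => ?_) hint'
      rw [uIcc_of_le hab.le] at hs
      have h1 : HasDerivAt (fun s => Real.exp t + K * (s - a)) K s := by
        simpa using (((hasDerivAt_id s).sub_const a).const_mul K).const_add (Real.exp t)
      have h2 : m / (Real.exp t + K * (s - a)) = m / K * (K / (Real.exp t + K * (s - a))) := by
        field_simp
      rw [h2]
      exact (h1.log (hpos s hs).ne').const_mul (m / K)
    have hlog : Real.log (K * (b - a)) ≤ Real.log (Real.exp t + K * (b - a)) :=
      Real.log_le_log hKab (le_add_of_nonneg_left (Real.exp_pos t).le)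
    calc L = m / K * Real.log (K * (b - a)) - m / K * t := by
          rw [ht]; field_simp; ring
      _ ≤ ∫ s in a..b, m / (Real.exp t + K * (s - a)) := by
          rw [heq, sub_self, mul_zero, add_zero, Real.log_exp]
          gcongr
      _ ≤ _ := by
          refine intervalIntegral.integral_mono_on hab.le hint' (hint t) fun s hs => ?_
          exact div_le_div₀ (hm.le.trans (hmc s)) (hmc s) (hden t s)
            (add_le_add_right (hqK s hs) _)
  obtain ⟨t, ht⟩ := mem_range_of_exists_le_of_exists_ge hcont hlow hhigh
  exact ⟨Real.exp t, Real.exp_pos t, ht⟩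

/-- The primitive of a continuous function bounded below by a positive constant is an
increasing bijection with continuously differentiable inverse. -/
lemma exists_inverse_primitive {k : ℝ → ℝ} {m : ℝ} (a : ℝ) (hk : Continuous k) (hm : 0 < m)
    (hmk : ∀ s, m ≤ k s) :
    ∃ H : ℝ → ℝ, Continuous H ∧ Monotone H ∧ (∀ x, H (∫ s in a..x, k s) = x) ∧
      ∀ y, HasDerivAt H (k (H y))⁻¹ y := by
  set G : ℝ → ℝ := fun x => ∫ s in a..x, k s with hG
  have hGd : ∀ x, HasDerivAt G (k x) x := fun x => hk.integral_hasStrictDerivAt a x |>.hasDerivAt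
  have hkpos : ∀ s, 0 < k s := fun s => hm.trans_le (hmk s)
  have hGmono : StrictMono G := strictMono_of_hasDerivAt_pos hGd hkpos
  have hdiff : Monotone fun x => G x - m * x := by
    refine monotone_of_hasDerivAt_nonneg (f' := fun x => k x - m) (fun x => ?_)
      fun x => sub_nonneg.2 (hmk x)
    exact (hGd x).fun_sub (by simpa using (hasDerivAt_id x).const_mul m)
  have hG0 : G a = 0 := intervalIntegral.integral_same
  have hsurj : Function.Surjective G := by
    refine Continuous.surjective (continuous_iff_continuousAt.2 fun x => (hGd x).continuousAt)
      ?_ ?_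
    · refine tendsto_atTop_mono' atTop ?_
        (tendsto_atTop_add_const_right atTop (-(m * a)) (tendsto_id.const_mul_atTop hm))
      filter_upwards [eventually_ge_atTop a] with x hx
      have := hdiff hx
      simp only [hG0, id] at this ⊢
      linarith
    · refine tendsto_atBot_mono' atBot ?_
        (tendsto_atBot_add_const_right atBot (-(m * a)) (tendsto_id.const_mul_atBot hm))
      filter_upwards [eventually_le_atBot a] with x hx
      have := hdiff hx
      simp only [hG0, id] at this ⊢
      linarith
  let e := hGmono.orderIsoOfSurjective G hsurj
  refine ⟨e.symm, e.symm.continuous, e.symm.monotone, fun x => e.symm_apply_apply x, fun y => ?_⟩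
  exact (hGd (e.symm y)).of_local_left_inverse e.symm.continuous.continuousAt (hkpos _).ne'
    (Eventually.of_forall fun z => e.apply_symm_apply z)

/-- Existence and uniqueness of the pair (parameter, solution) for the two-point boundary
value problem `c(w) w' = β - h(w)`, `w(-ℓ) = a`, `w(ℓ) = b`. -/
lemma exists_unique_two_point {S : Set ℝ} {a b K ℓ : ℝ} {c h : ℝ → ℝ} (hab : a < b)
    (hℓ : 0 < ℓ) (hK : 0 < K) (hS : Icc a b ⊆ S) (hc : ContinuousOn c S)
    (hcpos : ∀ s ∈ S, 0 < c s) (hh : ContinuousOn h S)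
    (hle : ∀ s ∈ Icc a b, h s ≤ h a) (hKle : ∀ s ∈ Icc a b, h a - h s ≤ K * (s - a)) :
    ∃ α : ℝ, ∃ u u' : ℝ → ℝ,
      (ContinuousOn u' (Icc (-ℓ) ℓ) ∧
        (∀ x ∈ Icc (-ℓ) ℓ, u x ∈ Icc a b ∧ HasDerivAt u (u' x) x ∧
          c (u x) * u' x = α - h (u x)) ∧
        u (-ℓ) = a ∧ u ℓ = b) ∧
      (∀ β : ℝ, ∀ w w' : ℝ → ℝ,
        (∀ x ∈ Icc (-ℓ) ℓ, w x ∈ S ∧ HasDerivAt w (w' x) x ∧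
          c (w x) * w' x = β - h (w x)) →
        w (-ℓ) = a → w ℓ = b → β = α ∧ ∀ x ∈ Icc (-ℓ) ℓ, w x = u x) := by
  let p : ℝ → ℝ := fun s => projIcc a b hab.le s
  have hp : Continuous p := continuous_subtype_val.comp continuous_projIcc
  have hpmem : ∀ s, p s ∈ Icc a b := fun s => (projIcc a b hab.le s).2
  have hpid : ∀ s ∈ Icc a b, p s = s := fun s hs => by
    simp only [p, projIcc_of_mem hab.le hs]
  have hcp : Continuous fun s => c (p s) :=
    hc.comp_continuous hp fun s => hS (hpmem s)
  have hqp : Continuous fun s => h a - h (p s) :=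
    continuous_const.sub (hh.comp_continuous hp fun s => hS (hpmem s))
  have hqp0 : ∀ s, 0 ≤ h a - h (p s) := fun s => sub_nonneg.2 (hle _ (hpmem s))
  have hbelow : ∀ f : ℝ → ℝ, Continuous (fun s => f (p s)) → (∀ s, 0 < f (p s)) →
      ∃ m > 0, ∀ s, m ≤ f (p s) := by
    intro f hf hf0
    obtain ⟨s₀, -, hs₀⟩ := isCompact_Icc.exists_isMinOn (nonempty_Icc.2 hab.le) hf.continuousOn
    refine ⟨f (p s₀), hf0 s₀, fun s => ?_⟩
    simpa only [mem_ofPred_eq, hpid _ (hpmem s)] using hs₀ (hpmem s)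
  obtain ⟨m, hm, hmc⟩ := hbelow c hcp fun s => hcpos _ (hS (hpmem s))
  obtain ⟨δ, hδ, hT⟩ := exists_integral_div_add_eq hab hK hm (by linarith : 0 < 2 * ℓ) hcp hqp hmc
    hqp0 fun s hs => by simpa only [hpid s hs] using hKle s hs
  have hden : ∀ s, 0 < δ + (h a - h (p s)) := fun s => add_pos_of_pos_of_nonneg hδ (hqp0 s)
  let k : ℝ → ℝ := fun s => c (p s) / (δ + (h a - h (p s)))
  have hk : Continuous k := hcp.div (continuous_const.add hqp) fun s => (hden s).ne'
  have hkpos : ∀ s, 0 < k s := fun s => div_pos (hcpos _ (hS (hpmem s))) (hden s)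
  obtain ⟨m', hm', hmk⟩ := hbelow (fun s => c s / (δ + (h a - h s))) hk hkpos
  obtain ⟨H, hHc, hHmono, hHinv, hHd⟩ := exists_inverse_primitive a hk hm' hmk
  have hH0 : H 0 = a := by simpa using hHinv a
  have hH1 : H (2 * ℓ) = b := by simpa only [k, hT] using hHinv b
  have hsol : (∀ x ∈ Icc (-ℓ) ℓ, H (x + ℓ) ∈ Icc a b ∧
      HasDerivAt (fun x => H (x + ℓ)) (k (H (x + ℓ)))⁻¹ x ∧
        c (H (x + ℓ)) * (k (H (x + ℓ)))⁻¹ = (δ + h a) - h (H (x + ℓ))) := by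
    intro x hx
    have hmem : H (x + ℓ) ∈ Icc a b :=
      ⟨hH0 ▸ hHmono (by linarith [hx.1]), hH1 ▸ hHmono (by linarith [hx.2])⟩
    refine ⟨hmem, (hHd (x + ℓ)).comp_add_const x ℓ, ?_⟩
    have h1 := hden (H (x + ℓ))
    have h2 := hcpos _ (hS hmem)
    simp only [k, hpid _ hmem] at h1 ⊢
    field_simp
    ring
  have hcompare : ∀ (β₁ β₂ : ℝ) (w₁ w₁' w₂ w₂' : ℝ → ℝ), β₁ < β₂ →
      (∀ x ∈ Icc (-ℓ) ℓ, w₁ x ∈ S ∧ HasDerivAt w₁ (w₁' x) x ∧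
        c (w₁ x) * w₁' x = β₁ - h (w₁ x)) →
      (∀ x ∈ Icc (-ℓ) ℓ, w₂ x ∈ S ∧ HasDerivAt w₂ (w₂' x) x ∧
        c (w₂ x) * w₂' x = β₂ - h (w₂ x)) →
      w₁ (-ℓ) = w₂ (-ℓ) → w₁ ℓ ≠ w₂ ℓ := by
    intro β₁ β₂ w₁ w₁' w₂ w₂' hβ h₁ h₂ h0 h1
    have := pos_of_deriv_pos_at_zeros (a := -ℓ) (b := ℓ) (d := fun x => w₂ x - w₁ x)
      (d' := fun x => w₂' x - w₁' x) (fun x hx => (h₂ x hx).2.1.sub (h₁ x hx).2.1)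
      (sub_eq_zero.2 h0.symm) (fun x hx hz => by
        have e : w₂ x = w₁ x := sub_eq_zero.1 hz
        obtain ⟨hs, -, e₁⟩ := h₁ x hx
        have e₂ := (h₂ x hx).2.2
        rw [e] at e₂
        refine pos_of_mul_pos_right (a := c (w₁ x)) ?_ (hcpos _ hs).le
        rw [mul_sub]
        linarith) ℓ ⟨by linarith, le_rfl⟩
    exact this.ne' (sub_eq_zero.2 h1.symm)
  refine ⟨δ + h a, fun x => H (x + ℓ), fun x => (k (H (x + ℓ)))⁻¹, ⟨?_, hsol, ?_, ?_⟩, ?_⟩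
  · exact (Continuous.inv₀ (by fun_prop) fun x => (hkpos _).ne').continuousOn
  · simpa using hH0
  · simpa [two_mul] using hH1
  intro β w w' hw hwa hwb
  have hsolS := fun x hx => And.intro (hS (hsol x hx).1) (hsol x hx).2
  have hβ : β = δ + h a := by
    rcases lt_trichotomy β (δ + h a) with hlt | heq | hgt
    · refine absurd ?_ (hcompare _ _ _ _ _ _ hlt hw hsolS ?_)
      · simp [hwb, ← two_mul, hH1]
      · simp [hwa, hH0]
    · exact heq
    · refine absurd ?_ (hcompare _ _ _ _ _ _ hgt hsolS hw ?_)
      · simp [hwb, ← two_mul, hH1]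
      · simp [hwa, hH0]
  refine ⟨hβ, ?_⟩
  have hw'pos : ∀ x ∈ Icc (-ℓ) ℓ, w x ∈ Icc a b → 0 < w' x := by
    intro x hx hwx
    refine pos_of_mul_pos_right (a := c (w x)) ?_ (hcpos _ (hS hwx)).le
    rw [(hw x hx).2.2, hβ]
    linarith [hle _ hwx]
  have hwge : ∀ x ∈ Icc (-ℓ) ℓ, a ≤ w x := by
    intro x hx
    rcases hx.1.eq_or_lt with rfl | hlt
    · exact hwa.ge
    refine sub_nonneg.1 (pos_of_deriv_pos_at_zeros (d := fun x => w x - a) (d' := w')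
      (fun y hy => (hw y hy).2.1.sub_const a) (sub_eq_zero.2 hwa) (fun y hy hz => ?_)
      x ⟨hlt, hx.2⟩).le
    exact hw'pos y hy ((sub_eq_zero.1 hz).symm ▸ left_mem_Icc.2 hab.le)
  have hwle : ∀ x ∈ Icc (-ℓ) ℓ, w x ≤ b := by
    intro x hx
    rcases hx.2.eq_or_lt with rfl | hlt
    · exact hwb.le
    have hneg : ∀ y ∈ Icc (-ℓ) ℓ, -y ∈ Icc (-ℓ) ℓ := fun y hy =>
      ⟨neg_le_neg hy.2, neg_le.1 hy.1⟩
    have := pos_of_deriv_pos_at_zeros (a := -ℓ) (b := ℓ) (d := fun y => b - w (-y))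
      (d' := fun y => w' (-y))
      (fun y hy => by
        simpa using (((hw _ (hneg y hy)).2.1.scomp y (hasDerivAt_neg y)).const_sub b))
      (by simp [hwb])
      (fun y hy hz => hw'pos _ (hneg y hy) (sub_eq_zero.1 hz ▸ right_mem_Icc.2 hab.le))
      (-x) ⟨neg_lt_neg hlt, neg_le.1 hx.1⟩
    simpa using this.le
  have hderiv : ∀ x ∈ Icc (-ℓ) ℓ,
      HasDerivAt (fun x => (∫ s in a..w x, k s) - x) 0 x := by
    intro x hx
    have hwx : w x ∈ Icc a b := ⟨hwge x hx, hwle x hx⟩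
    have hprim := (hk.integral_hasStrictDerivAt a (w x)).hasDerivAt
    suffices hk1 : k (w x) * w' x = 1 by
      have hsub := (hprim.comp x (hw x hx).2.1).fun_sub (hasDerivAt_id' x)
      rw [hk1, sub_self] at hsub
      exact hsub
    have h1 := hden (w x)
    have h2 := (hw x hx).2.2
    simp only [k, hpid _ hwx] at h1 ⊢
    rw [div_mul_eq_mul_div, h2, hβ, div_eq_one_iff_eq h1.ne']
    ring
  intro x hx
  have hconst := constant_of_has_deriv_right_zero
    (fun y hy => (hderiv y hy).continuousAt.continuousWithinAt)
    (fun y hy => (hderiv y (Ico_subset_Icc_self hy)).hasDerivWithinAt) x hx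
  rw [hwa, intervalIntegral.integral_same, zero_sub, neg_neg] at hconst
  rw [← hHinv (w x), sub_eq_iff_eq_add'.1 hconst]

/-- existence and uniqueness of the stationary solution.  Under the
pressure, viscosity and flux-potential assumptions and the compatibility conditions
**H2**, there exist a unique constant `α` and a unique C¹ function `ū : [-ℓ, ℓ] → (0,∞)`
with `ū(-ℓ) = u₋`, `ū(ℓ) = u₊` solving
`ε·v₋·(ν(ū)/ū)·ū' = -P(ū)·ū + α·ū - v₋²` on `[-ℓ, ℓ]`. -/
theorem stmt8 (ε ℓ um up vm : ℝ) (P P' P'' ν Φ : ℝ → ℝ)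
    (hε : 0 < ε) (hℓ : 0 < ℓ) (hum : 0 < um) (humup : um < up) (hvm : 0 < vm)
    (hPC2 : ContDiffOn ℝ 2 P (Set.Ioi 0))
    (hP'def : ∀ s > (0 : ℝ), HasDerivAt P (P' s) s)
    (hP''def : ∀ s > (0 : ℝ), HasDerivAt P' (P'' s) s)
    (hP0 : Filter.Tendsto P (nhdsWithin 0 (Set.Ioi 0)) (nhds 0))
    (hPtop : Filter.Tendsto P Filter.atTop Filter.atTop)
    (hP'pos : ∀ s > (0 : ℝ), 0 < P' s)
    (hP''pos : ∀ s > (0 : ℝ), 0 < P'' s)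
    (hPint : ∀ a > (0 : ℝ),
      IntervalIntegrable (fun z => P z / z ^ 2) MeasureTheory.volume 0 a)
    (hνc : ContinuousOn ν (Set.Ioi 0)) (hνpos : ∀ s > (0 : ℝ), 0 < ν s)
    (hΦmono : StrictMonoOn Φ (Set.Ioi 0)) (hΦpos : ∀ u > (0 : ℝ), 0 < Φ u)
    (hΦ'def : ∀ u > (0 : ℝ), HasDerivAt Φ (ν u / u) u)
    (hΦ0 : Filter.Tendsto Φ (nhdsWithin 0 (Set.Ioi 0)) (nhds 0))
    (hΦtop : Filter.Tendsto Φ Filter.atTop Filter.atTop)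
    -- compatibility conditions H2 (with f(u) = u·∫₀ᵘ P(z)/z² dz,
    -- so that f'(u) = ∫₀ᵘ P(z)/z² dz + P(u)/u):
    (hcomp1 : vm ^ 2 * (up - um) = um * up * (P up - P um))
    (hcomp2 :
      (vm ^ 3 / (2 * up ^ 2) + vm * ((∫ z in (0:ℝ)..up, P z / z ^ 2) + P up / up)) -
      (vm ^ 3 / (2 * um ^ 2) + vm * ((∫ z in (0:ℝ)..um, P z / z ^ 2) + P um / um)) ≤ 0) :
    ∃ α : ℝ, ∃ ubar ubar' : ℝ → ℝ,
      (ContinuousOn ubar' (Set.Icc (-ℓ) ℓ) ∧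
        (∀ x ∈ Set.Icc (-ℓ) ℓ, 0 < ubar x ∧ HasDerivAt ubar (ubar' x) x ∧
          ε * vm * (ν (ubar x) / ubar x) * ubar' x =
            -P (ubar x) * ubar x + α * ubar x - vm ^ 2) ∧
        ubar (-ℓ) = um ∧ ubar ℓ = up) ∧
      -- uniqueness of the pair (α, ū) among all C¹ positive solutions
      (∀ β : ℝ, ∀ w w' : ℝ → ℝ,
        (ContinuousOn w' (Set.Icc (-ℓ) ℓ) ∧
          (∀ x ∈ Set.Icc (-ℓ) ℓ, 0 < w x ∧ HasDerivAt w (w' x) x ∧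
            ε * vm * (ν (w x) / w x) * w' x =
              -P (w x) * w x + β * w x - vm ^ 2) ∧
          w (-ℓ) = um ∧ w ℓ = up) →
        β = α ∧ ∀ x ∈ Set.Icc (-ℓ) ℓ, w x = ubar x) := by
  have hPcont : ContinuousOn P (Ioi 0) := hPC2.continuousOn
  have hsub : Icc um up ⊆ Ioi 0 := fun s hs => hum.trans_le hs.1
  have hPconv : ConvexOn ℝ (Ioi 0) P := by
    refine convexOn_of_hasDerivWithinAt2_nonneg (convex_Ioi 0) hPcont
      (f' := P') (f'' := P'') ?_ ?_ ?_ <;> rw [interior_Ioi]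
    · exact fun s hs => (hP'def s hs).hasDerivWithinAt
    · exact fun s hs => (hP''def s hs).hasDerivWithinAt
    · exact fun s hs => (hP''pos s hs).le
  have hPmono : MonotoneOn P (Ioi 0) := by
    refine monotoneOn_of_hasDerivWithinAt_nonneg (convex_Ioi 0) hPcont (f' := P') ?_ ?_ <;>
      rw [interior_Ioi]
    · exact fun s hs => (hP'def s hs).hasDerivWithinAt
    · exact fun s hs => (hP'pos s hs).le
  have hup : 0 < up := hum.trans humup
  let h : ℝ → ℝ := fun s => P s + vm ^ 2 * s ^ (-1 : ℤ)
  have hconv : ConvexOn ℝ (Ioi 0) h :=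
    hPconv.add ((convexOn_zpow (-1)).smul (sq_nonneg vm))
  have heq : h um = h up := by
    simp only [h, zpow_neg_one]
    field_simp
    linarith
  have hcν : ContinuousOn (fun s => ε * vm * ν s / s ^ 2) (Ioi 0) :=
    (continuousOn_const.mul hνc).div (by fun_prop) fun s hs => pow_ne_zero 2 (ne_of_gt hs)
  have hcpos : ∀ s ∈ Ioi (0 : ℝ), 0 < ε * vm * ν s / s ^ 2 := fun s hs =>
    div_pos (mul_pos (mul_pos hε hvm) (hνpos s hs)) (pow_pos hs 2)
  have hhc : ContinuousOn h (Ioi 0) :=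
    hPcont.add (continuousOn_const.mul (continuousOn_id.zpow₀ _ fun s hs => Or.inl (ne_of_gt hs)))
  have hle : ∀ s ∈ Icc um up, h s ≤ h um := fun s hs => by
    simpa [← heq] using hconv.le_max_of_mem_Icc hum hup hs
  have hKle : ∀ s ∈ Icc um up, h um - h s ≤ vm ^ 2 / um ^ 2 * (s - um) := by
    intro s hs
    have hs0 : 0 < s := hsub hs
    have hPs := hPmono hum hs0 hs.1
    have hinv : um⁻¹ - s⁻¹ ≤ (s - um) / um ^ 2 := by
      rw [inv_sub_inv hum.ne' hs0.ne', sq]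
      exact div_le_div_of_nonneg_left (sub_nonneg.2 hs.1) (mul_pos hum hum)
        (mul_le_mul_of_nonneg_left hs.1 hum.le)
    have := mul_le_mul_of_nonneg_left hinv (sq_nonneg vm)
    simp only [h, zpow_neg_one]
    rw [div_mul_eq_mul_div, mul_div_assoc]
    linarith
  have hode : ∀ β y y' : ℝ, 0 < y →
      (ε * vm * (ν y / y) * y' = -P y * y + β * y - vm ^ 2 ↔
        ε * vm * ν y / y ^ 2 * y' = β - h y) := by
    intro β y y' hy
    have e1 : ε * vm * (ν y / y) * y' = y * (ε * vm * ν y / y ^ 2 * y') := by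
      field_simp
    have e2 : -P y * y + β * y - vm ^ 2 = y * (β - h y) := by
      simp only [h, zpow_neg_one]
      field_simp
      ring
    rw [e1, e2, mul_right_inj' hy.ne']
  obtain ⟨α, u, u', ⟨hu', hu, hua, hub⟩, huniq⟩ :=
    exists_unique_two_point humup hℓ (by positivity) hsub hcν hcpos hhc hle hKle
  refine ⟨α, u, u', ⟨hu', fun x hx => ?_, hua, hub⟩, fun β w w' hw => ?_⟩
  · obtain ⟨hmem, hd, he⟩ := hu x hx
    exact ⟨hsub hmem, hd, (hode _ _ _ (hsub hmem)).2 he⟩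
  · refine huniq β w w' (fun x hx => ?_) hw.2.2.1 hw.2.2.2
    obtain ⟨h0, hd, he⟩ := hw.2.1 x hx
    exact ⟨h0, hd, (hode _ _ _ h0).1 he⟩
end

section
/- Let κ > 0, v* > 0, and u₋, u₊ > 0 with u₋ ≠ u₊ and v*² = (1/2)·κ·u₋·u₊·(u₋ + u₊). If v*³/(2u₊²) + κ·v*·u₊ ≤ v*³/(2u₋²) + κ·v*·u₋, then u₋ < u₊. -/
/-- hydraulic jump for Saint-Venant: if `v*² = (1/2)κ·u₋·u₊·(u₋+u₊)` and
the entropy condition `v*³/(2u₊²) + κv*u₊ ≤ v*³/(2u₋²) + κv*u₋` holds, then `u₋ < u₊`. -/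
theorem stmt14 (κ vs um up : ℝ) (hκ : 0 < κ) (hvs : 0 < vs)
    (hum : 0 < um) (hup : 0 < up) (hne : um ≠ up)
    (hRH : vs ^ 2 = (1/2) * κ * um * up * (um + up))
    (hent : vs ^ 3 / (2 * up ^ 2) + κ * vs * up ≤ vs ^ 3 / (2 * um ^ 2) + κ * vs * um) :
    um < up := by
  have hjump : vs ^ 3 / (2 * up ^ 2) + κ * vs * up - (vs ^ 3 / (2 * um ^ 2) + κ * vs * um)
      = κ * vs * (um - up) ^ 3 / (4 * um * up) := by
    have hcube : vs ^ 3 = vs * ((1/2) * κ * um * up * (um + up)) := by rw [← hRH]; ring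
    rw [hcube]
    field_simp
    ring
  by_contra! hle
  have hdiff : 0 < um - up := sub_pos.mpr (lt_of_le_of_ne hle hne.symm)
  have hpos : 0 < κ * vs * (um - up) ^ 3 / (4 * um * up) := by positivity
  linarith
end

section
/- Under the hypotheses of the Lyapunov-derivative proposition (in particular, a classical solution (u, v) on [−ℓ, ℓ] × [0, T] for which the Lyapunov functional L(t) := ∫_{−ℓ}^{ℓ} [ (v − v̄)²/(2u) + u·∫_{ū}^{u}(P(z) − P(ū))/z² dz ] dx satisfies L(t) ≤ L(0) for all t ∈ [0, T], and with 1/M ≤ u ≤ M and 1/M ≤ ū ≤ M for some M > 0), there exists a constant C > 0 depending only on M and on P such that sup_{0 ≤ t ≤ T} ( ‖u(·, t) − ū‖_{L²(−ℓ,ℓ)} + ‖v(·, t) − v̄‖_{L²(−ℓ,ℓ)} ) ≤ C·( ‖u(·, 0) − ū‖_{L²(−ℓ,ℓ)} + ‖v(·, 0) − v̄‖_{L²(−ℓ,ℓ)} ). -/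
open Set intervalIntegral in
/-- If `f z` lies above the line `k (z - b)` to the right of `b` and below it to the left, then
`∫ z in b..a, f z ≥ k (a - b) ^ 2 / 2`, whichever of `a`, `b` is larger. -/
theorem mul_sq_div_two_le_integral {f : ℝ → ℝ} {a b k : ℝ} (hf : ContinuousOn f (uIcc b a))
    (h : ∀ z ∈ uIcc b a, k * (z - b) ^ 2 ≤ f z * (z - b)) :
    k * (a - b) ^ 2 / 2 ≤ ∫ z in b..a, f z := by
  have hline : ∫ z in b..a, k * (z - b) = k * (a - b) ^ 2 / 2 := by
    rw [integral_const_mul, integral_comp_sub_right (fun z => z), integral_id]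
    ring
  have hfi : IntervalIntegrable f MeasureTheory.volume b a := hf.intervalIntegrable
  have hli : IntervalIntegrable (fun z => k * (z - b)) MeasureTheory.volume b a :=
    (by fun_prop : Continuous fun z => k * (z - b)).intervalIntegrable _ _
  rw [← hline]
  rcases le_total b a with hab | hab
  · refine integral_mono_on_of_le_Ioo hab hli hfi fun z hz => ?_
    have hz' := h z (by rw [uIcc_of_le hab]; exact Ioo_subset_Icc_self hz)
    exact le_of_mul_le_mul_right (by linarith) (sub_pos.2 hz.1)
  · rw [integral_symm a b, integral_symm a b, neg_le_neg_iff]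
    refine integral_mono_on_of_le_Ioo hab hfi.symm hli.symm fun z hz => ?_
    have hz' := h z (by rw [uIcc_of_ge hab]; exact Ioo_subset_Icc_self hz)
    exact le_of_mul_le_mul_right (by linarith) (sub_pos.2 hz.2)

/-- The upper counterpart of `mul_sq_div_two_le_integral`. -/
theorem integral_le_mul_sq_div_two {f : ℝ → ℝ} {a b k : ℝ} (hf : ContinuousOn f (Set.uIcc b a))
    (h : ∀ z ∈ Set.uIcc b a, f z * (z - b) ≤ k * (z - b) ^ 2) :
    ∫ z in b..a, f z ≤ k * (a - b) ^ 2 / 2 := by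
  have := mul_sq_div_two_le_integral (f := fun z => -f z) (k := -k) hf.neg
    fun z hz => by linarith [h z hz]
  rw [intervalIntegral.integral_neg] at this
  linarith

theorem mul_sq_le_sub_mul_sub_of_le_deriv {f f' : ℝ → ℝ} {s : Set ℝ} (hs : Convex ℝ s) {m : ℝ}
    (hf : ∀ x ∈ s, HasDerivAt f (f' x) x) (hm : ∀ x ∈ s, m ≤ f' x) {x y : ℝ}
    (hx : x ∈ s) (hy : y ∈ s) : m * (x - y) ^ 2 ≤ (f x - f y) * (x - y) := by
  have key : ∀ x ∈ s, ∀ y ∈ s, x ≤ y → m * (y - x) ≤ f y - f x :=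
    hs.mul_sub_le_image_sub_of_le_deriv
      (fun x hx => (hf x hx).continuousAt.continuousWithinAt)
      (fun x hx => (hf x (interior_subset hx)).differentiableAt.differentiableWithinAt)
      (fun x hx => (hf x (interior_subset hx)).deriv ▸ hm x (interior_subset hx))
  rcases le_total x y with h | h
  · nlinarith [key x hx y hy h]
  · nlinarith [key y hy x hx h]

theorem sub_mul_sub_le_mul_sq_of_deriv_le {f f' : ℝ → ℝ} {s : Set ℝ} (hs : Convex ℝ s) {m : ℝ}
    (hf : ∀ x ∈ s, HasDerivAt f (f' x) x) (hm : ∀ x ∈ s, f' x ≤ m) {x y : ℝ}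
    (hx : x ∈ s) (hy : y ∈ s) : (f x - f y) * (x - y) ≤ m * (x - y) ^ 2 := by
  have := mul_sq_le_sub_mul_sub_of_le_deriv (f := -f) (f' := -f') hs (m := -m)
    (fun x hx => (hf x hx).neg) (fun x hx => neg_le_neg (hm x hx)) hx hy
  simp only [Pi.neg_apply] at this
  linarith

/-- The Lyapunov density at velocity deviation `w`, state `a` and reference state `b`. -/
noncomputable def lyapunovDensity (P : ℝ → ℝ) (w a b : ℝ) : ℝ :=
  w ^ 2 / (2 * a) + a * ∫ z in b..a, (P z - P b) / z ^ 2

theorem continuousOn_sub_div_sq {P : ℝ → ℝ} (hP : ContinuousOn P (Set.Ioi 0)) (c : ℝ) :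
    ContinuousOn (fun z => (P z - c) / z ^ 2) (Set.Ioi 0) :=
  (hP.sub continuousOn_const).div (by fun_prop) fun _ hz => pow_ne_zero 2 (ne_of_gt hz)

theorem uIcc_subset_Ioi {a b c : ℝ} (ha : c < a) (hb : c < b) : Set.uIcc a b ⊆ Set.Ioi c :=
  Set.ordConnected_Ioi.uIcc_subset ha hb

theorem lyapunovDensity_bounds {P P' : ℝ → ℝ} {M m₀ m₁ : ℝ} (hM : 0 < M) (hm₀ : 0 ≤ m₀)
    (hm₁ : 0 ≤ m₁) (hP : ∀ s > (0 : ℝ), HasDerivAt P (P' s) s)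
    (hlow : ∀ s ∈ Set.Icc (1 / M) M, m₀ ≤ P' s) (hupp : ∀ s ∈ Set.Icc (1 / M) M, P' s ≤ m₁)
    {a b : ℝ} (ha : a ∈ Set.Icc (1 / M) M) (hb : b ∈ Set.Icc (1 / M) M) (w : ℝ) :
    1 / (2 * M) * w ^ 2 + m₀ / (2 * M ^ 3) * (a - b) ^ 2 ≤ lyapunovDensity P w a b ∧
      lyapunovDensity P w a b ≤ M / 2 * w ^ 2 + m₁ * M ^ 3 / 2 * (a - b) ^ 2 := by
  have hM' : 0 < 1 / M := one_div_pos.2 hM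
  have ha0 : 0 < a := hM'.trans_le ha.1
  have hb0 : 0 < b := hM'.trans_le hb.1
  have hmem : ∀ z ∈ Set.uIcc b a, z ∈ Set.Icc (1 / M) M :=
    fun z hz => Set.ordConnected_Icc.uIcc_subset hb ha hz
  have hder : ∀ s ∈ Set.Icc (1 / M) M, HasDerivAt P (P' s) s :=
    fun s hs => hP s (hM'.trans_le hs.1)
  have hcont : ContinuousOn (fun z => (P z - P b) / z ^ 2) (Set.uIcc b a) :=
    (continuousOn_sub_div_sq
      (fun s hs => (hP s hs).continuousAt.continuousWithinAt) _).mono (uIcc_subset_Ioi hb0 ha0)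
  have hI₀ : m₀ / M ^ 2 * (a - b) ^ 2 / 2 ≤ ∫ z in b..a, (P z - P b) / z ^ 2 := by
    refine mul_sq_div_two_le_integral hcont fun z hz => ?_
    have hz' := hmem z hz
    have hz0 : 0 < z := hM'.trans_le hz'.1
    calc m₀ / M ^ 2 * (z - b) ^ 2 = m₀ * (z - b) ^ 2 / M ^ 2 := by ring
      _ ≤ (P z - P b) * (z - b) / z ^ 2 := by
        have hmv := mul_sq_le_sub_mul_sub_of_le_deriv (convex_Icc _ _) hder hlow hz' hb
        have : 0 ≤ m₀ * (z - b) ^ 2 := by positivity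
        have := hz'.2
        gcongr
        linarith
      _ = (P z - P b) / z ^ 2 * (z - b) := by ring
  have hI₁ : ∫ z in b..a, (P z - P b) / z ^ 2 ≤ m₁ * M ^ 2 * (a - b) ^ 2 / 2 := by
    refine integral_le_mul_sq_div_two hcont fun z hz => ?_
    have hz' := hmem z hz
    have hz0 : 0 < z := hM'.trans_le hz'.1
    calc (P z - P b) / z ^ 2 * (z - b) = (P z - P b) * (z - b) / z ^ 2 := by ring
      _ ≤ m₁ * (z - b) ^ 2 / (1 / M) ^ 2 := by
        have hmv := sub_mul_sub_le_mul_sq_of_deriv_le (convex_Icc _ _) hder hupp hz' hb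
        have := hz'.1
        gcongr
      _ = m₁ * M ^ 2 * (z - b) ^ 2 := by field_simp
  have hI : 0 ≤ ∫ z in b..a, (P z - P b) / z ^ 2 := le_trans (by positivity) hI₀
  have hw₀ : 1 / (2 * M) * w ^ 2 ≤ w ^ 2 / (2 * a) := by
    rw [one_div_mul_eq_div]
    have := ha.2
    gcongr
  have hw₁ : w ^ 2 / (2 * a) ≤ M / 2 * w ^ 2 := by
    calc w ^ 2 / (2 * a) ≤ w ^ 2 / (2 * (1 / M)) := by
          have := ha.1
          gcongr
      _ = M / 2 * w ^ 2 := by field_simp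
  constructor
  · refine add_le_add hw₀ ?_
    calc m₀ / (2 * M ^ 3) * (a - b) ^ 2 = 1 / M * (m₀ / M ^ 2 * (a - b) ^ 2 / 2) := by
          field_simp
      _ ≤ _ := mul_le_mul ha.1 hI₀ (by positivity) ha0.le
  · refine add_le_add hw₁ ?_
    calc _ ≤ M * (m₁ * M ^ 2 * (a - b) ^ 2 / 2) := mul_le_mul ha.2 hI₁ hI hM.le
      _ = _ := by ring

/-- Along continuous curves, the Lyapunov density is continuous where both states are positive. -/
theorem continuousOn_lyapunovDensity {P : ℝ → ℝ} (hP : ContinuousOn P (Set.Ioi 0)) {s : Set ℝ}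
    {w a b : ℝ → ℝ} (hw : ContinuousOn w s) (ha : ContinuousOn a s) (hb : ContinuousOn b s)
    (ha0 : ∀ x ∈ s, 0 < a x) (hb0 : ∀ x ∈ s, 0 < b x) :
    ContinuousOn (fun x => lyapunovDensity P (w x) (a x) (b x)) s := by
  have hint : ∀ c p q : ℝ, 0 < p → 0 < q →
      IntervalIntegrable (fun z => (P z - c) / z ^ 2) MeasureTheory.volume p q :=
    fun c p q hp hq =>
      ((continuousOn_sub_div_sq hP c).mono (uIcc_subset_Ioi hp hq)).intervalIntegrable
  have hprim : ∀ c, ContinuousOn (fun y => ∫ z in (1 : ℝ)..y, (P z - c) / z ^ 2) (Set.Ioi 0) := by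
    intro c y hy
    refine (intervalIntegral.integral_hasDerivAt_right (hint c 1 y one_pos hy) ?_ ?_
      ).continuousAt.continuousWithinAt
    · exact (continuousOn_sub_div_sq hP c).stronglyMeasurableAtFilter isOpen_Ioi y hy
    · exact (continuousOn_sub_div_sq hP c).continuousAt (isOpen_Ioi.mem_nhds hy)
  have hsplit : ∀ x ∈ s, (∫ z in (b x)..(a x), (P z - P (b x)) / z ^ 2) =
      ((∫ z in (1 : ℝ)..(a x), (P z - 0) / z ^ 2) - ∫ z in (1 : ℝ)..(b x), (P z - 0) / z ^ 2) +
      P (b x) * ((∫ z in (1 : ℝ)..(a x), (P z - 1) / z ^ 2) -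
        (∫ z in (1 : ℝ)..(b x), (P z - 1) / z ^ 2) -
        ((∫ z in (1 : ℝ)..(a x), (P z - 0) / z ^ 2) -
          ∫ z in (1 : ℝ)..(b x), (P z - 0) / z ^ 2)) := by
    intro x hx
    have h := fun c => intervalIntegral.integral_interval_sub_left
      (hint c 1 (a x) one_pos (ha0 x hx)) (hint c 1 (b x) one_pos (hb0 x hx))
    have h₀ := hint 0 (b x) (a x) (hb0 x hx) (ha0 x hx)
    have h₁ := hint 1 (b x) (a x) (hb0 x hx) (ha0 x hx)
    rw [h 0, h 1, ← intervalIntegral.integral_sub h₁ h₀, ← intervalIntegral.integral_const_mul,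
      ← intervalIntegral.integral_add h₀ ((h₁.sub h₀).const_mul _)]
    congr 1
    ext z
    ring
  have hA := fun c => (hprim c).comp ha ha0
  have hB := fun c => (hprim c).comp hb hb0
  have hPb := hP.comp hb hb0
  have hinner : ContinuousOn (fun x => ∫ z in (b x)..(a x), (P z - P (b x)) / z ^ 2) s :=
    (((hA 0).sub (hB 0)).add (hPb.mul (((hA 1).sub (hB 1)).sub ((hA 0).sub (hB 0))))).congr hsplit
  exact ((hw.pow 2).div (continuousOn_const.mul ha)
    fun x hx => mul_ne_zero two_ne_zero (ha0 x hx).ne').add (ha.mul hinner)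

theorem sqrt_add_sqrt_le_of_add_le {X Y X₀ Y₀ K : ℝ} (hX : 0 ≤ X) (hY : 0 ≤ Y) (hX₀ : 0 ≤ X₀)
    (hY₀ : 0 ≤ Y₀) (hK : 0 ≤ K) (h : X + Y ≤ K * (X₀ + Y₀)) :
    √X + √Y ≤ √(2 * K) * (√X₀ + √Y₀) := by
  refine abs_le_of_sq_le_sq' ?_ (by positivity) |>.2
  rw [mul_pow, Real.sq_sqrt (by positivity)]
  have h₁ : (√X + √Y) ^ 2 ≤ 2 * (X + Y) := by
    nlinarith [sq_nonneg (√X - √Y), Real.sq_sqrt hX, Real.sq_sqrt hY]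
  have h₂ : X₀ + Y₀ ≤ (√X₀ + √Y₀) ^ 2 := by
    nlinarith [Real.sq_sqrt hX₀, Real.sq_sqrt hY₀,
      mul_nonneg (Real.sqrt_nonneg X₀) (Real.sqrt_nonneg Y₀)]
  nlinarith [mul_le_mul_of_nonneg_left h₂ hK]


/-- L²-stability of the steady state.  If the Lyapunov functional
`L(t) = ∫_{-ℓ}^{ℓ} [(v-v̄)²/(2u) + u·∫_{ū}^{u}(P(z)-P(ū))/z² dz] dx` satisfies
`L(t) ≤ L(0)` on `[0,T]` and `1/M ≤ u, ū ≤ M`, then there is a constant `C > 0`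
depending only on `M` and on `P` such that
`sup_{0≤t≤T} (‖u(·,t)-ū‖_{L²} + ‖v(·,t)-v̄‖_{L²}) ≤ C(‖u(·,0)-ū‖_{L²} + ‖v(·,0)-v̄‖_{L²})`. -/
theorem stmt18 (P P' P'' : ℝ → ℝ)
    (hPC2 : ContDiffOn ℝ 2 P (Set.Ioi 0))
    (hP'def : ∀ s > (0 : ℝ), HasDerivAt P (P' s) s)
    (hP''def : ∀ s > (0 : ℝ), HasDerivAt P' (P'' s) s)
    (hP0 : Filter.Tendsto P (nhdsWithin 0 (Set.Ioi 0)) (nhds 0))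
    (hPtop : Filter.Tendsto P Filter.atTop Filter.atTop)
    (hP'pos : ∀ s > (0 : ℝ), 0 < P' s)
    (hP''pos : ∀ s > (0 : ℝ), 0 < P'' s) :
    ∀ M > (0 : ℝ), ∃ C > (0 : ℝ),
      ∀ ℓ T : ℝ, 0 < ℓ → 0 ≤ T →
      ∀ u v : ℝ × ℝ → ℝ, ∀ ubar : ℝ → ℝ, ∀ vbar : ℝ,
        Continuous u → Continuous v → Continuous ubar →
        -- bounds 1/M ≤ u ≤ M and 1/M ≤ ū ≤ M
        (∀ x ∈ Set.Icc (-ℓ) ℓ, ∀ t ∈ Set.Icc 0 T,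
          1 / M ≤ u (x, t) ∧ u (x, t) ≤ M) →
        (∀ x ∈ Set.Icc (-ℓ) ℓ, 1 / M ≤ ubar x ∧ ubar x ≤ M) →
        -- the Lyapunov functional is non-increasing from its initial value
        (∀ t ∈ Set.Icc 0 T,
          (∫ x in -ℓ..ℓ, ((v (x, t) - vbar) ^ 2 / (2 * u (x, t)) +
            u (x, t) * ∫ z in (ubar x)..(u (x, t)), (P z - P (ubar x)) / z ^ 2)) ≤
          (∫ x in -ℓ..ℓ, ((v (x, 0) - vbar) ^ 2 / (2 * u (x, 0)) +
            u (x, 0) * ∫ z in (ubar x)..(u (x, 0)), (P z - P (ubar x)) / z ^ 2))) →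
        -- L²-stability estimate
        ∀ t ∈ Set.Icc 0 T,
          Real.sqrt (∫ x in -ℓ..ℓ, (u (x, t) - ubar x) ^ 2) +
            Real.sqrt (∫ x in -ℓ..ℓ, (v (x, t) - vbar) ^ 2) ≤
          C * (Real.sqrt (∫ x in -ℓ..ℓ, (u (x, 0) - ubar x) ^ 2) +
            Real.sqrt (∫ x in -ℓ..ℓ, (v (x, 0) - vbar) ^ 2)) := by
  intro M hM
  have hM' : 0 < 1 / M := one_div_pos.2 hM
  have hmono : MonotoneOn P' (Set.Ioi 0) :=
    monotoneOn_of_deriv_nonneg (convex_Ioi 0)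
      (fun s hs => (hP''def s hs).continuousAt.continuousWithinAt)
      (fun s hs => (hP''def s (interior_subset hs)).differentiableAt.differentiableWithinAt)
      (fun s hs => (hP''def s (interior_subset hs)).deriv ▸ (hP''pos s (interior_subset hs)).le)
  have hm₀ := hP'pos (1 / M) hM'
  have hm₁ := hP'pos M hM
  have hlow : ∀ s ∈ Set.Icc (1 / M) M, P' (1 / M) ≤ P' s :=
    fun s hs => hmono hM' (hM'.trans_le hs.1) hs.1
  have hupp : ∀ s ∈ Set.Icc (1 / M) M, P' s ≤ P' M :=
    fun s hs => hmono (hM'.trans_le hs.1) hM hs.2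
  set α := min (1 / (2 * M)) (P' (1 / M) / (2 * M ^ 3)) with hα
  set β := max (M / 2) (P' M * M ^ 3 / 2) with hβ
  have hα0 : 0 < α := lt_min (by positivity) (by positivity)
  have hβ0 : 0 < β := lt_max_of_lt_left (by positivity)
  refine ⟨√(2 * (β / α)), by positivity, ?_⟩
  intro ℓ T hℓ hT u v ubar vbar hu hv hub hubd hubbd hL t ht
  have hℓ' : -ℓ ≤ ℓ := by linarith
  have hcont : ∀ τ ∈ Set.Icc 0 T, IntervalIntegrable
      (fun x => lyapunovDensity P (v (x, τ) - vbar) (u (x, τ)) (ubar x))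
      MeasureTheory.volume (-ℓ) ℓ := by
    intro τ hτ
    refine ContinuousOn.intervalIntegrable ?_
    rw [Set.uIcc_of_le hℓ']
    exact continuousOn_lyapunovDensity
      (fun s hs => (hP'def s hs).continuousAt.continuousWithinAt)
      (by fun_prop) (by fun_prop) (by fun_prop)
      (fun x hx => hM'.trans_le (hubd x hx τ hτ).1) (fun x hx => hM'.trans_le (hubbd x hx).1)
  have hui : ∀ τ, IntervalIntegrable (fun x => (u (x, τ) - ubar x) ^ 2)
      MeasureTheory.volume (-ℓ) ℓ := fun τ =>
    (by fun_prop : Continuous fun x => (u (x, τ) - ubar x) ^ 2).intervalIntegrable _ _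
  have hvi : ∀ τ, IntervalIntegrable (fun x => (v (x, τ) - vbar) ^ 2)
      MeasureTheory.volume (-ℓ) ℓ := fun τ =>
    (by fun_prop : Continuous fun x => (v (x, τ) - vbar) ^ 2).intervalIntegrable _ _
  have hsum : ∀ c τ, ∫ x in -ℓ..ℓ, c * ((u (x, τ) - ubar x) ^ 2 + (v (x, τ) - vbar) ^ 2) =
      c * ((∫ x in -ℓ..ℓ, (u (x, τ) - ubar x) ^ 2) + ∫ x in -ℓ..ℓ, (v (x, τ) - vbar) ^ 2) :=
    fun c τ => by
      rw [intervalIntegral.integral_const_mul, intervalIntegral.integral_add (hui τ) (hvi τ)]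
  have hbd := fun τ (hτ : τ ∈ Set.Icc 0 T) x (hx : x ∈ Set.Icc (-ℓ) ℓ) =>
    lyapunovDensity_bounds hM hm₀.le hm₁.le hP'def hlow hupp (hubd x hx τ hτ) (hubbd x hx)
      (v (x, τ) - vbar)
  have h0 : (0 : ℝ) ∈ Set.Icc 0 T := ⟨le_rfl, hT⟩
  have hlower : α * ((∫ x in -ℓ..ℓ, (u (x, t) - ubar x) ^ 2) +
      ∫ x in -ℓ..ℓ, (v (x, t) - vbar) ^ 2) ≤
      ∫ x in -ℓ..ℓ, lyapunovDensity P (v (x, t) - vbar) (u (x, t)) (ubar x) := by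
    rw [← hsum]
    refine intervalIntegral.integral_mono_on hℓ' (((hui t).add (hvi t)).const_mul α) (hcont t ht)
      fun x hx => le_trans ?_ (hbd t ht x hx).1
    rw [mul_add, add_comm]
    gcongr
    · exact min_le_left _ _
    · exact min_le_right _ _
  have hupper : ∫ x in -ℓ..ℓ, lyapunovDensity P (v (x, 0) - vbar) (u (x, 0)) (ubar x) ≤
      β * ((∫ x in -ℓ..ℓ, (u (x, 0) - ubar x) ^ 2) + ∫ x in -ℓ..ℓ, (v (x, 0) - vbar) ^ 2) := by
    rw [← hsum]
    refine intervalIntegral.integral_mono_on hℓ' (hcont 0 h0) (((hui 0).add (hvi 0)).const_mul β)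
      fun x hx => (hbd 0 h0 x hx).2.trans ?_
    rw [mul_add, add_comm]
    gcongr
    · exact le_max_right _ _
    · exact le_max_left _ _
  have hnonneg : ∀ f : ℝ → ℝ, 0 ≤ ∫ x in -ℓ..ℓ, f x ^ 2 := fun f =>
    intervalIntegral.integral_nonneg hℓ' fun x _ => sq_nonneg (f x)
  refine sqrt_add_sqrt_le_of_add_le (hnonneg _) (hnonneg _) (hnonneg _) (hnonneg _)
    (by positivity) ?_
  rw [div_mul_eq_mul_div, le_div_iff₀ hα0, mul_comm]
  exact hlower.trans ((hL t ht).trans hupper)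
end
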